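/- arXiv:1109.5662 — 2 statements merged into one kernel-verified Lean document; each statement's English description precedes it below -/
import Mathlib

section
/- For every p with 2 ≤ p < ∞ there exists a constant C > 0 such that for every Schwartz function f : ℝ³ → ℂ and every t > 0, ‖e^{itΛ} f‖_{L^p(ℝ³)} ≤ C · t^{−(1 − 2/p)} · ‖Λ^{2 − 4/p} f‖_{L^{p'}(ℝ³)}, where p' is the dual Hölder exponent, 1/p + 1/p' = 1. -/
open MeasureTheory
open scoped InnerProductSpace FourierTransform ENNReal

/-- The half-wave propagator e^{itΛ}, defined on the Fourier side by
(e^{itΛ}f)(x) = ∫ e^{2πi⟨x,ξ⟩} e^{2πit‖ξ‖} f̂(ξ) dξ. -/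
noncomputable def halfWave (t : ℝ) (f : EuclideanSpace ℝ (Fin 3) → ℂ)
    (x : EuclideanSpace ℝ (Fin 3)) : ℂ :=
  ∫ ξ : EuclideanSpace ℝ (Fin 3),
    Complex.exp (2 * Real.pi * Complex.I * ((⟪x, ξ⟫_ℝ + t * ‖ξ‖ : ℝ) : ℂ)) * 𝓕 f ξ

/-- The Fourier multiplier Λˢ = (2π|∇|)ˢ: Λˢf is the inverse Fourier transform of
ξ ↦ (2π‖ξ‖)ˢ f̂(ξ). -/
noncomputable def lambdaPow (s : ℝ) (f : EuclideanSpace ℝ (Fin 3) → ℂ)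
    (x : EuclideanSpace ℝ (Fin 3)) : ℂ :=
  ∫ ξ : EuclideanSpace ℝ (Fin 3),
    Complex.exp (2 * Real.pi * Complex.I * ((⟪x, ξ⟫_ℝ : ℝ) : ℂ)) *
      (((2 * Real.pi * ‖ξ‖) ^ s : ℝ) : ℂ) * 𝓕 f ξ

section L2Fourier

variable {V : Type*} [NormedAddCommGroup V] [InnerProductSpace ℝ V] [FiniteDimensional ℝ V]
  [MeasurableSpace V] [BorelSpace V]

theorem continuous_fourier_of_integrable {f : V → ℂ} (hf : Integrable f) : Continuous (𝓕 f) :=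
  VectorFourier.fourierIntegral_continuous Real.continuous_fourierChar
    (innerSL ℝ).continuous₂ hf

theorem continuous_fourierInv_of_integrable {f : V → ℂ} (hf : Integrable f) :
    Continuous (𝓕⁻ f) := by
  rw [Real.fourierInv_eq_fourier_comp_neg]
  exact continuous_fourier_of_integrable hf.comp_neg

theorem norm_fourier_le_integral_norm (f : V → ℂ) (x : V) : ‖𝓕 f x‖ ≤ ∫ v, ‖f v‖ :=
  VectorFourier.norm_fourierIntegral_le_integral_norm _ _ _ _ _

theorem norm_fourierInv_le_integral_norm (f : V → ℂ) (x : V) : ‖𝓕⁻ f x‖ ≤ ∫ v, ‖f v‖ := by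
  rw [Real.fourierInv_eq_fourier_neg]
  exact norm_fourier_le_integral_norm f _

theorem integral_fourier_mul_eq_flip {f g : V → ℂ} (hf : Integrable f) (hg : Integrable g) :
    ∫ ξ, 𝓕 f ξ * g ξ = ∫ x, f x * 𝓕 g x := by
  simpa using! VectorFourier.integral_fourierIntegral_smul_eq_flip (L := innerₗ V)
    Real.continuous_fourierChar continuous_inner hf hg

theorem integral_fourierInv_mul_eq_flip {f g : V → ℂ} (hf : Integrable f) (hg : Integrable g) :
    ∫ ξ, 𝓕⁻ f ξ * g ξ = ∫ x, f x * 𝓕⁻ g x := by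
  rw [Real.fourierInv_eq_fourier_comp_neg, Real.fourierInv_eq_fourier_comp_neg,
    integral_fourier_mul_eq_flip hf.comp_neg hg, ← integral_neg_eq_self]
  simp [← Real.fourierInv_eq_fourier_neg, Real.fourierInv_eq_fourier_comp_neg]

/-- On `L¹ ∩ L²` the Fourier transform of `L²` is given by the Fourier integral. -/
theorem coeFn_fourier_toLp {f : V → ℂ} (h1 : Integrable f) (h2 : MemLp f 2) :
    ((𝓕 (h2.toLp f) : Lp (α := V) ℂ 2) : V → ℂ) =ᵐ[volume] 𝓕 f := by
  apply ae_eq_of_integral_contDiff_smul_eq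
  · exact (Lp.memLp _).locallyIntegrable (by norm_num)
  · exact (continuous_fourier_of_integrable h1).locallyIntegrable
  · intro g g_smooth g_cpt
    have hg₁ : HasCompactSupport (Complex.ofRealCLM ∘ g) := g_cpt.comp_left rfl
    set G : SchwartzMap V ℂ := hg₁.toSchwartzMap (Complex.ofRealCLM.contDiff.comp g_smooth)
    have hG : ∀ x, G x = g x := fun x => by simp [G]
    have e1 := congrArg (fun T => T G) (Lp.fourier_toTemperedDistribution_eq (h2.toLp f))
    simp only [TemperedDistribution.fourier_apply, Lp.toTemperedDistribution_apply,
      smul_eq_mul] at e1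
    simp only [Complex.real_smul, ← hG]
    rw [← e1]
    calc _ = ∫ x, 𝓕 (G : V → ℂ) x * f x := by
          apply integral_congr_ae
          filter_upwards [h2.coeFn_toLp] with x hx
          rw [hx, SchwartzMap.fourier_coe]
      _ = _ := integral_fourier_mul_eq_flip G.integrable h1

theorem memLp_two_fourier {f : V → ℂ} (h1 : Integrable f) (h2 : MemLp f 2) : MemLp (𝓕 f) 2 :=
  (memLp_congr_ae (coeFn_fourier_toLp h1 h2)).1 (Lp.memLp _)

theorem eLpNorm_two_fourier {f : V → ℂ} (h1 : Integrable f) (h2 : MemLp f 2) :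
    eLpNorm (𝓕 f) 2 = eLpNorm f 2 := by
  rw [← eLpNorm_congr_ae (coeFn_fourier_toLp h1 h2), ← eLpNorm_congr_ae h2.coeFn_toLp]
  rw [← ENNReal.toReal_eq_toReal_iff' (Lp.eLpNorm_ne_top _) (Lp.eLpNorm_ne_top _),
    ← Lp.norm_def, ← Lp.norm_def, Lp.norm_fourier_eq]

theorem memLp_two_fourierInv {f : V → ℂ} (h1 : Integrable f) (h2 : MemLp f 2) :
    MemLp (𝓕⁻ f) 2 := by
  rw [Real.fourierInv_eq_fourier_comp_neg]
  exact memLp_two_fourier h1.comp_neg (h2.comp_measurePreserving (Measure.measurePreserving_neg _))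

theorem eLpNorm_two_fourierInv {f : V → ℂ} (h1 : Integrable f) (h2 : MemLp f 2) :
    eLpNorm (𝓕⁻ f) 2 = eLpNorm f 2 := by
  have hn := Measure.measurePreserving_neg (volume : Measure V)
  rw [Real.fourierInv_eq_fourier_comp_neg,
    eLpNorm_two_fourier h1.comp_neg (h2.comp_measurePreserving hn)]
  exact eLpNorm_comp_measurePreserving h2.1 hn

/-- The inverse Fourier integral of `f ∈ L¹ ∩ L²` is inverted by the Fourier transform of `L²`. -/
theorem coeFn_fourierInv_toLp {f : V → ℂ} (h1 : Integrable f) (h2 : MemLp f 2) :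
    ((𝓕⁻ (h2.toLp f) : Lp (α := V) ℂ 2) : V → ℂ) =ᵐ[volume] 𝓕⁻ f := by
  apply ae_eq_of_integral_contDiff_smul_eq
  · exact (Lp.memLp _).locallyIntegrable (by norm_num)
  · exact (continuous_fourierInv_of_integrable h1).locallyIntegrable
  · intro g g_smooth g_cpt
    have hg₁ : HasCompactSupport (Complex.ofRealCLM ∘ g) := g_cpt.comp_left rfl
    set G : SchwartzMap V ℂ := hg₁.toSchwartzMap (Complex.ofRealCLM.contDiff.comp g_smooth)
    have hG : ∀ x, G x = g x := fun x => by simp [G]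
    have e1 := congrArg (fun T => T G) (Lp.fourierInv_toTemperedDistribution_eq (h2.toLp f))
    simp only [TemperedDistribution.fourierInv_apply, Lp.toTemperedDistribution_apply,
      smul_eq_mul] at e1
    simp only [Complex.real_smul, ← hG]
    rw [← e1]
    calc _ = ∫ x, 𝓕⁻ (G : V → ℂ) x * f x := by
          apply integral_congr_ae
          filter_upwards [h2.coeFn_toLp] with x hx
          rw [hx, SchwartzMap.fourierInv_coe]
      _ = _ := integral_fourierInv_mul_eq_flip G.integrable h1

/-- If `φ ∈ L¹ ∩ L²` and `H ∈ L¹ ∩ L²` then `‖𝓕 φ - H‖₂ = ‖φ - 𝓕⁻ H‖₂`. -/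
theorem eLpNorm_fourier_sub {φ H : V → ℂ} (h1 : Integrable φ) (h2 : MemLp φ 2)
    (H1 : Integrable H) (H2 : MemLp H 2) :
    eLpNorm (𝓕 φ - H) 2 = eLpNorm (φ - 𝓕⁻ H) 2 := by
  have a1 := ((coeFn_fourier_toLp h1 h2).symm.sub H2.coeFn_toLp.symm).trans
    (Lp.coeFn_sub (𝓕 (h2.toLp φ)) (H2.toLp H)).symm
  have a2 := (h2.coeFn_toLp.symm.sub (coeFn_fourierInv_toLp H1 H2).symm).trans
    (Lp.coeFn_sub (h2.toLp φ) (𝓕⁻ (H2.toLp H))).symm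
  rw [eLpNorm_congr_ae a1, eLpNorm_congr_ae a2,
    ← ENNReal.toReal_eq_toReal_iff' (Lp.eLpNorm_ne_top _) (Lp.eLpNorm_ne_top _),
    ← Lp.norm_def, ← Lp.norm_def, ← Lp.norm_fourier_eq (h2.toLp φ - _), sub_eq_add_neg,
    sub_eq_add_neg, FourierTransform.fourier_add, ← neg_one_smul ℂ (𝓕⁻ _),
    FourierTransform.fourier_smul, FourierTransform.fourier_fourierInv_eq, neg_one_smul]

end L2Fourier

section Radial

/-- Cylindrical coordinates on `ℝ³` around the axis spanned by a unit vector. -/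
theorem exists_cylindrical_coordinates {e : EuclideanSpace ℝ (Fin 3)} (he : ‖e‖ = 1) :
    ∃ Ψ : EuclideanSpace ℝ (Fin 3) ≃ᵐ ℝ × ℂ, MeasurePreserving Ψ volume volume ∧
      ∀ ξ, (Ψ ξ).1 = ⟪e, ξ⟫_ℝ ∧ ‖ξ‖ = √((Ψ ξ).1 ^ 2 + ‖(Ψ ξ).2‖ ^ 2) := by
  obtain ⟨b, hb⟩ := Orthonormal.exists_orthonormalBasis_extension_of_card_eq (𝕜 := ℝ)
    (E := EuclideanSpace ℝ (Fin 3)) (ι := Fin 3) (by simp) (v := fun _ => e) (s := {0})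
    ⟨fun _ => he, fun i j hij => (hij (Subsingleton.elim i j)).elim⟩
  have hb0 : b 0 = e := hb 0 rfl
  let Ψ : EuclideanSpace ℝ (Fin 3) ≃ᵐ ℝ × ℂ :=
    (b.measurableEquiv.trans (MeasurableEquiv.toLp 2 (Fin 3 → ℝ)).symm).trans
      ((MeasurableEquiv.piFinSuccAbove (fun _ => ℝ) 0).trans
        ((MeasurableEquiv.refl ℝ).prodCongr Complex.measurableEquivPi.symm))
  refine ⟨Ψ, ?_, fun ξ => ?_⟩
  · exact ((b.measurePreserving_measurableEquiv.trans
      (PiLp.volume_preserving_ofLp (Fin 3))).trans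
        ((volume_preserving_piFinSuccAbove (fun _ => ℝ) 0).trans
          ((MeasurePreserving.id volume).prod Complex.volume_preserving_equiv_pi.symm)))
  · have h1 : (Ψ ξ).1 = b.repr ξ 0 := rfl
    have h2 : (Ψ ξ).2 = ⟨b.repr ξ 1, b.repr ξ 2⟩ := by
      change Complex.measurableEquivPi.symm _ = _
      rw [MeasurableEquiv.symm_apply_eq, Complex.measurableEquivPi_apply]
      ext i
      fin_cases i <;> rfl
    refine ⟨by rw [h1, b.repr_apply_apply, hb0], ?_⟩
    rw [← b.repr.norm_map, EuclideanSpace.norm_eq, h1, h2, Fin.sum_univ_three,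
      Complex.sq_norm, Complex.normSq_mk]
    simp only [Real.norm_eq_abs, sq_abs]
    ring_nf

theorem integral_sin_mul_cexp_cos {b : ℝ} (hb : b ≠ 0) :
    ∫ φ in Set.Ioo 0 Real.pi,
        (Real.sin φ : ℂ) * Complex.exp (Complex.I * (b * Real.cos φ : ℝ)) =
      (Complex.exp (Complex.I * b) - Complex.exp (-(Complex.I * b))) / (Complex.I * b) := by
  have hb' : (b : ℂ) ≠ 0 := by exact_mod_cast hb
  rw [← integral_Ioc_eq_integral_Ioo, ← intervalIntegral.integral_of_le Real.pi_pos.le]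
  have hd : ∀ φ ∈ Set.uIcc 0 Real.pi, HasDerivAt
      (fun φ : ℝ => -Complex.exp (Complex.I * (b * Real.cos φ : ℝ)) / (Complex.I * b))
      ((Real.sin φ : ℂ) * Complex.exp (Complex.I * (b * Real.cos φ : ℝ))) φ := by
    intro φ _
    have h1 : HasDerivAt (fun φ : ℝ => ((b * Real.cos φ : ℝ) : ℂ)) ((b * -Real.sin φ : ℝ) : ℂ) φ :=
      ((Real.hasDerivAt_cos φ).const_mul b).ofReal_comp
    convert! (((h1.const_mul Complex.I).cexp).neg).div_const (Complex.I * b) using 1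
    push_cast
    field_simp
  rw [intervalIntegral.integral_eq_sub_of_hasDerivAt hd]
  · simp
    field_simp
    ring
  · apply Continuous.intervalIntegrable
    fun_prop

/-- The Fourier integral of a radial function on `ℝ³` as a one dimensional oscillatory integral. -/
theorem fourierInv_radial {m : ℝ → ℂ} (hm : Measurable m)
    (hi : Integrable fun ξ : EuclideanSpace ℝ (Fin 3) => m ‖ξ‖)
    {x : EuclideanSpace ℝ (Fin 3)} (hx : x ≠ 0) :
    𝓕⁻ (fun ξ : EuclideanSpace ℝ (Fin 3) => m ‖ξ‖) x =
      (∫ r in Set.Ioi (0 : ℝ), r * m r * (Complex.exp (Complex.I * (2 * Real.pi * ‖x‖ * r : ℝ)) -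
        Complex.exp (-(Complex.I * (2 * Real.pi * ‖x‖ * r : ℝ))))) / (Complex.I * ‖x‖) := by
  have hρ : 0 < ‖x‖ := norm_pos_iff.2 hx
  set a : ℝ := 2 * Real.pi * ‖x‖ with ha
  have ha0 : 0 < a := by positivity
  obtain ⟨Ψ, hΨ, hc⟩ := exists_cylindrical_coordinates (e := ‖x‖⁻¹ • x)
    (by rw [norm_smul, norm_inv, norm_norm, inv_mul_cancel₀ hρ.ne'])
  have hr2 : IntegrableOn (fun r : ℝ => (r : ℂ) ^ 2 * m r) (Set.Ioi 0) := by
    have := (integrable_fun_norm_addHaar (E := EuclideanSpace ℝ (Fin 3)) volume (f := m)).1 hi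
    simpa using this
  let g : ℝ × ℝ → ℂ := fun q => (Set.univ ×ˢ Set.Ioi 0 : Set (ℝ × ℝ)).indicator (fun q =>
    q.2 * m (√(q.1 ^ 2 + q.2 ^ 2)) * Complex.exp (Complex.I * (a * q.1 : ℝ))) q
  let P : ℝ × ℝ → ℂ := fun p => ((p.1 : ℂ) ^ 2 * m p.1) *
    ((Real.sin p.2 : ℂ) * Complex.exp (Complex.I * (a * p.1 * Real.cos p.2 : ℝ)))
  have hgm : Measurable g := by
    apply Measurable.indicator _ (MeasurableSet.univ.prod measurableSet_Ioi)
    have : Measurable fun q : ℝ × ℝ => m (√(q.1 ^ 2 + q.2 ^ 2)) := hm.comp (by fun_prop)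
    fun_prop
  have hgP : ∀ p ∈ polarCoord.target, p.1 • g (polarCoord.symm p) =
      (Set.Ioi 0 ×ˢ Set.Ioo 0 Real.pi : Set (ℝ × ℝ)).indicator P p := by
    rintro ⟨r, φ⟩ ⟨hr, hφ⟩
    simp only [Set.mem_Ioi] at hr
    simp only [polarCoord_symm_apply, g, P]
    have hn : √((r * Real.cos φ) ^ 2 + (r * Real.sin φ) ^ 2) = r := by
      rw [show (r * Real.cos φ) ^ 2 + (r * Real.sin φ) ^ 2 = r ^ 2 by
        rw [← mul_one (r ^ 2), ← Real.cos_sq_add_sin_sq φ]; ring]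
      exact Real.sqrt_sq hr.le
    by_cases hp : 0 < φ
    · have hs : 0 < Real.sin φ := Real.sin_pos_of_pos_of_lt_pi hp hφ.2
      have hmem : (r * Real.cos φ, r * Real.sin φ) ∈ (Set.univ ×ˢ Set.Ioi 0 : Set (ℝ × ℝ)) :=
        ⟨trivial, mul_pos hr hs⟩
      have hmem' : (r, φ) ∈ (Set.Ioi 0 ×ˢ Set.Ioo 0 Real.pi : Set (ℝ × ℝ)) := ⟨hr, hp, hφ.2⟩
      rw [Set.indicator_of_mem hmem, Set.indicator_of_mem hmem', hn]
      simp only [Complex.real_smul]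
      push_cast
      ring_nf
    · have hs : Real.sin φ ≤ 0 := Real.sin_nonpos_of_nonpos_of_neg_pi_le (not_lt.1 hp) hφ.1.le
      rw [Set.indicator_of_notMem, Set.indicator_of_notMem, smul_zero]
      · exact fun h => hp h.2.1
      · exact fun h => (mul_nonpos_of_nonneg_of_nonpos hr.le hs).not_gt h.2
  have hsub : (Set.Ioi 0 ×ˢ Set.Ioo 0 Real.pi : Set (ℝ × ℝ)) ⊆ polarCoord.target := by
    rintro ⟨r, φ⟩ ⟨hr, hφ⟩
    exact ⟨hr, by linarith [hφ.1, Real.pi_pos], hφ.2⟩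
  have hmeas : MeasurableSet (Set.Ioi 0 ×ˢ Set.Ioo 0 Real.pi : Set (ℝ × ℝ)) :=
    measurableSet_Ioi.prod measurableSet_Ioo
  have hPi : IntegrableOn P (Set.Ioi 0 ×ˢ Set.Ioo 0 Real.pi) := by
    have h1 : Integrable (fun _ : ℝ => (1 : ℂ)) (volume.restrict (Set.Ioo 0 Real.pi)) :=
      integrable_const _
    have h2 := hr2.mul_prod h1
    rw [IntegrableOn, Measure.volume_eq_prod, ← Measure.prod_restrict]
    apply h2.mono
    · apply Measurable.aestronglyMeasurable
      have : Measurable fun p : ℝ × ℝ => m p.1 := hm.comp measurable_fst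
      fun_prop
    · refine Filter.Eventually.of_forall fun p => ?_
      simp only [P, norm_mul, Complex.norm_real, mul_comm Complex.I, Complex.norm_exp_ofReal_mul_I,
        mul_one]
      exact mul_le_of_le_one_right (by positivity) (Real.abs_sin_le_one _)
  have hgi : Integrable g := by
    refine ⟨hgm.aestronglyMeasurable, ?_⟩
    rw [hasFiniteIntegral_iff_enorm, ← lintegral_comp_polarCoord_symm]
    calc _ = ∫⁻ p in polarCoord.target, ‖(Set.Ioi 0 ×ˢ Set.Ioo 0 Real.pi :
          Set (ℝ × ℝ)).indicator P p‖ₑ := by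
          apply setLIntegral_congr_fun polarCoord.open_target.measurableSet
          intro p hp
          simp only
          rw [← hgP p hp, enorm_smul, smul_eq_mul, Real.enorm_of_nonneg (le_of_lt hp.1)]
      _ ≤ ∫⁻ p, ‖(Set.Ioi 0 ×ˢ Set.Ioo 0 Real.pi : Set (ℝ × ℝ)).indicator P p‖ₑ :=
          setLIntegral_le_lintegral _ _
      _ < ⊤ := ((integrable_indicator_iff hmeas).2 hPi).2
  have hF : 𝓕⁻ (fun ξ : EuclideanSpace ℝ (Fin 3) => m ‖ξ‖) x = ∫ q : ℝ × ℂ,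
      m (√(q.1 ^ 2 + ‖q.2‖ ^ 2)) * Complex.exp (Complex.I * (a * q.1 : ℝ)) := by
    rw [Real.fourierInv_eq', ← hΨ.integral_comp Ψ.measurableEmbedding]
    congr 1 with ξ
    obtain ⟨h1, h2⟩ := hc ξ
    rw [← h2, h1, inner_smul_left, real_inner_comm, smul_eq_mul, mul_comm, ha, mul_comm Complex.I]
    congr 4
    simp
    field_simp
  have hFi : Integrable fun q : ℝ × ℂ =>
      m (√(q.1 ^ 2 + ‖q.2‖ ^ 2)) * Complex.exp (Complex.I * (a * q.1 : ℝ)) := by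
    rw [← hΨ.integrable_comp_emb Ψ.measurableEmbedding]
    apply hi.mono
    · apply Measurable.aestronglyMeasurable
      have : Measurable fun q : ℝ × ℂ => m (√(q.1 ^ 2 + ‖q.2‖ ^ 2)) := hm.comp (by fun_prop)
      exact Measurable.comp (by fun_prop) Ψ.measurable
    · refine Filter.Eventually.of_forall fun ξ => ?_
      simp only [Function.comp, norm_mul, mul_comm Complex.I, Complex.norm_exp_ofReal_mul_I,
        mul_one, ← (hc ξ).2, le_refl]
  have hg2 : ∀ z : ℝ, ∫ w : ℂ, m (√(z ^ 2 + ‖w‖ ^ 2)) * Complex.exp (Complex.I * (a * z : ℝ)) =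
      2 * Real.pi * ∫ s, g (z, s) := by
    intro z
    have h1 := integral_fun_norm_addHaar (E := ℂ) volume
      (fun s => m (√(z ^ 2 + s ^ 2)) * Complex.exp (Complex.I * (a * z : ℝ)))
    rw [h1, Complex.finrank_real_complex]
    have h2 : (volume : Measure ℂ).real (Metric.ball 0 1) = Real.pi := by
      simp [Measure.real]
    have h3 : ∀ s, g (z, s) = (Set.Ioi 0).indicator (fun s : ℝ => (s ^ (2 - 1)) •
        (m (√(z ^ 2 + s ^ 2)) * Complex.exp (Complex.I * (a * z : ℝ)))) s := by
      intro s
      simp only [g, Set.indicator, Set.mem_prod, Set.mem_univ, true_and, Complex.real_smul]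
      split_ifs
      · simp [mul_assoc]
      · rfl
    simp_rw [h3]
    rw [integral_indicator measurableSet_Ioi, h2, nsmul_eq_mul, Complex.real_smul]
    push_cast
    ring
  rw [hF, Measure.volume_eq_prod, integral_prod _ hFi]
  simp_rw [hg2]
  rw [integral_const_mul, ← integral_prod _ hgi, ← Measure.volume_eq_prod,
    ← integral_comp_polarCoord_symm,
    setIntegral_congr_fun polarCoord.open_target.measurableSet hgP,
    setIntegral_indicator hmeas, Set.inter_eq_right.2 hsub, Measure.volume_eq_prod,
    setIntegral_prod _ hPi, ← integral_const_mul, ← integral_div]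
  apply setIntegral_congr_fun measurableSet_Ioi
  intro r hr
  have hr0 : (r : ℂ) ≠ 0 := by exact_mod_cast (ne_of_gt hr)
  have hρ' : (‖x‖ : ℂ) ≠ 0 := by exact_mod_cast hρ.ne'
  have hπ : (Real.pi : ℂ) ≠ 0 := by exact_mod_cast Real.pi_ne_zero
  simp only [P]
  rw [integral_const_mul, integral_sin_mul_cexp_cos (mul_pos ha0 hr).ne', ha]
  push_cast
  field_simp

end Radial

section OscillatoryGamma

theorem norm_cpow_le_of_re_pos {c : ℂ} (hc : 0 < c.re) (γ : ℝ) :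
    ‖c ^ (2 * γ * Complex.I : ℂ)‖ ≤ Real.exp (Real.pi * |γ|) := by
  have h0 : c ≠ 0 := by rintro rfl; simp at hc
  have harg : |c.arg| ≤ Real.pi / 2 := Complex.abs_arg_le_pi_div_two_iff.2 hc.le
  rw [Complex.cpow_def_of_ne_zero h0, Complex.norm_exp]
  apply Real.exp_le_exp.2
  have : (Complex.log c * (2 * γ * Complex.I)).re = -(2 * γ * c.arg) := by
    simp [Complex.mul_re, Complex.mul_im, Complex.log_im]
    ring
  rw [this]
  calc -(2 * γ * c.arg) ≤ |2 * γ * c.arg| := neg_le_abs _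
    _ = 2 * |γ| * |c.arg| := by rw [abs_mul, abs_mul, abs_two]
    _ ≤ 2 * |γ| * (Real.pi / 2) := by gcongr
    _ = _ := by ring

theorem norm_ofReal_cpow_I {r : ℝ} (hr : 0 < r) (γ : ℝ) :
    ‖(r : ℂ) ^ (-(2 * γ * Complex.I) : ℂ)‖ = 1 := by
  rw [Complex.norm_cpow_eq_rpow_re_of_pos hr]; simp

theorem norm_Gamma_one_sub_le (γ : ℝ) : ‖Complex.Gamma (1 - 2 * γ * Complex.I)‖ ≤ 1 := by
  rw [Complex.Gamma_eq_integral (by simp), Complex.GammaIntegral]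
  calc _ ≤ ∫ r in Set.Ioi (0:ℝ), ‖((-r).exp : ℂ) * (r : ℂ) ^ (1 - 2 * γ * Complex.I - 1 : ℂ)‖ :=
        norm_integral_le_integral_norm _
    _ = ∫ r in Set.Ioi (0:ℝ), Real.exp (-r) := by
        refine setIntegral_congr_fun measurableSet_Ioi fun r hr => ?_
        have : (1 - 2 * γ * Complex.I - 1 : ℂ) = -(2 * γ * Complex.I) := by ring
        simp only [this, norm_mul, norm_ofReal_cpow_I hr, mul_one, Complex.norm_real,
          Real.norm_eq_abs, Real.abs_exp]
    _ = 1 := integral_exp_neg_Ioi_zero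

theorem measurable_ofReal_cpow (w : ℂ) : Measurable fun r : ℝ => (r : ℂ) ^ w := by
  fun_prop

theorem integrableOn_id_mul_exp_neg {b : ℝ} (hb : 0 < b) :
    IntegrableOn (fun r : ℝ => r * Real.exp (-(b * r))) (Set.Ioi 0) := by
  have := integrableOn_rpow_mul_exp_neg_mul_rpow (p := 1) (s := 1) (b := b) (by norm_num)
    one_pos hb
  simpa using this

theorem integrableOn_exp_neg_mul {b : ℝ} (hb : 0 < b) :
    IntegrableOn (fun r : ℝ => Real.exp (-(b * r))) (Set.Ioi 0) := by
  simpa using integrableOn_exp_mul_Ioi (a := -b) (neg_lt_zero.2 hb) 0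

theorem norm_cexp_neg_mul (c : ℂ) (r : ℝ) : ‖Complex.exp (-(c * r))‖ = Real.exp (-(c.re * r)) := by
  rw [Complex.norm_exp]; simp

theorem integrableOn_cpow_mul_cexp_neg (γ : ℝ) {c : ℂ} (hc : 0 < c.re) :
    IntegrableOn (fun r : ℝ => (r : ℂ) ^ (-(2 * γ * Complex.I) : ℂ) * Complex.exp (-(c * r)))
      (Set.Ioi 0) := by
  refine Integrable.mono' (g := fun r => Real.exp (-(c.re * r))) ?_ ?_ ?_
  · exact integrableOn_exp_neg_mul hc
  · exact ((measurable_ofReal_cpow _).mul (by fun_prop)).aestronglyMeasurable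
  · refine (ae_restrict_mem measurableSet_Ioi).mono fun r hr => ?_
    rw [norm_mul, norm_ofReal_cpow_I hr, one_mul, norm_cexp_neg_mul]

theorem integral_cpow_mul_cexp_neg (γ : ℝ) {c : ℂ} (hc : 0 < c.re) :
    ∫ r in Set.Ioi (0:ℝ), (r : ℂ) ^ (-(2 * γ * Complex.I) : ℂ) * Complex.exp (-(c * r)) =
      c ^ (-(1 - 2 * γ * Complex.I) : ℂ) * Complex.Gamma (1 - 2 * γ * Complex.I) := by
  set U : Set ℂ := {c | 0 < c.re} with hU
  have hUo : IsOpen U := isOpen_lt continuous_const Complex.continuous_re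
  have hUc : IsPreconnected U := (convex_halfSpace_re_gt 0).isPreconnected
  have hL : DifferentiableOn ℂ (fun c : ℂ => ∫ r in Set.Ioi (0:ℝ),
      (r : ℂ) ^ (-(2 * γ * Complex.I) : ℂ) * Complex.exp (-(c * r))) U := by
    intro c hc
    have hc' : 0 < c.re := hc
    refine DifferentiableAt.differentiableWithinAt (HasDerivAt.differentiableAt
      (hasDerivAt_integral_of_dominated_loc_of_deriv_le
      (s := {d : ℂ | c.re / 2 < d.re})
      (bound := fun r => r * Real.exp (-(c.re / 2 * r)))
      (F' := fun d r => (r : ℂ) ^ (-(2 * γ * Complex.I) : ℂ) * (Complex.exp (-(d * r)) * -r))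
      ?_ ?_ ?_ ?_ ?_ ?_ ?_).2)
    · exact (isOpen_lt continuous_const Complex.continuous_re).mem_nhds (by
        simp only [Set.mem_ofPred_eq]; linarith)
    · exact Filter.Eventually.of_forall fun d =>
        ((measurable_ofReal_cpow _).mul (by fun_prop)).aestronglyMeasurable
    · exact integrableOn_cpow_mul_cexp_neg γ hc
    · exact ((measurable_ofReal_cpow _).mul (by fun_prop)).aestronglyMeasurable
    · refine (ae_restrict_mem measurableSet_Ioi).mono fun r hr d hd => ?_
      have hr : 0 < r := hr
      have hd : c.re / 2 < d.re := hd
      rw [norm_mul, norm_ofReal_cpow_I hr, one_mul, norm_mul, norm_cexp_neg_mul, norm_neg,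
        Complex.norm_real, Real.norm_eq_abs, abs_of_pos hr, mul_comm]
      gcongr
    · exact integrableOn_id_mul_exp_neg (by linarith)
    · refine Filter.Eventually.of_forall fun r d _ => ?_
      have h1 : HasDerivAt (fun d : ℂ => -(d * r)) (-r : ℂ) d := by
        simpa using ((hasDerivAt_id d).mul_const (r : ℂ)).fun_neg
      exact h1.cexp.const_mul _
  have hR : DifferentiableOn ℂ (fun c : ℂ => c ^ (-(1 - 2 * γ * Complex.I) : ℂ) *
      Complex.Gamma (1 - 2 * γ * Complex.I)) U := by
    intro c hc
    refine DifferentiableAt.differentiableWithinAt (DifferentiableAt.mul_const ?_ _)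
    exact differentiableAt_id.cpow_const (Or.inl hc)
  have key := (hL.analyticOnNhd hUo).eqOn_of_preconnected_of_frequently_eq
    (hR.analyticOnNhd hUo) hUc (z₀ := 1) (by simp [hU]) ?_
  · exact key hc
  · have hev : ∀ᶠ r : ℝ in nhdsWithin 1 {1}ᶜ, (∫ s in Set.Ioi (0:ℝ),
        (s : ℂ) ^ (-(2 * γ * Complex.I) : ℂ) * Complex.exp (-((r : ℂ) * s))) =
        (r : ℂ) ^ (-(1 - 2 * γ * Complex.I) : ℂ) * Complex.Gamma (1 - 2 * γ * Complex.I) := by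
      filter_upwards [mem_nhdsWithin_of_mem_nhds (lt_mem_nhds (show (0:ℝ) < 1 by norm_num))]
        with r hr
      have := Complex.integral_cpow_mul_exp_neg_mul_Ioi (a := 1 - 2 * γ * Complex.I) (by simp) hr
      rw [show (1 - 2 * γ * Complex.I - 1 : ℂ) = -(2 * γ * Complex.I) by ring] at this
      rw [this, one_div, ← Complex.ofReal_inv, Complex.ofReal_inv, Complex.inv_cpow _ _ ?_,
        Complex.cpow_neg]
      rw [Complex.arg_ofReal_of_nonneg hr.le]
      exact Real.pi_pos.ne
    have ht : Filter.Tendsto (fun r : ℝ => (r : ℂ)) (nhdsWithin 1 {1}ᶜ) (nhdsWithin 1 {1}ᶜ) := by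
      refine tendsto_nhdsWithin_iff.2 ⟨?_, ?_⟩
      · have : Filter.Tendsto (fun r : ℝ => (r : ℂ)) (nhds 1) (nhds ((1:ℝ):ℂ)) :=
          Complex.continuous_ofReal.tendsto 1
        rw [Complex.ofReal_one] at this
        exact this.mono_left nhdsWithin_le_nhds
      · filter_upwards [self_mem_nhdsWithin] with r hr
        simpa using hr
    exact ht.frequently hev.frequently

end OscillatoryGamma

section OscillatoryKernel

theorem norm_cexp_sub_cexp_le (η α β : ℝ) {r : ℝ} (hr : 0 ≤ r) :
    ‖Complex.exp (-((η - α * Complex.I) * r)) - Complex.exp (-((η - β * Complex.I) * r))‖ ≤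
      |α - β| * (r * Real.exp (-(η * r))) := by
  have h : Complex.exp (-((η - α * Complex.I) * r)) - Complex.exp (-((η - β * Complex.I) * r)) =
      Complex.exp (-((η - β * Complex.I) * r)) *
        (Complex.exp (Complex.I * ((α - β) * r : ℝ)) - 1) := by
    rw [mul_sub, ← Complex.exp_add, mul_one]
    congr 2
    push_cast; ring
  rw [h, norm_mul, norm_cexp_neg_mul]
  have h2 := Real.norm_exp_I_mul_ofReal_sub_one_le (x := (α - β) * r)
  rw [Real.norm_eq_abs, abs_mul, abs_of_nonneg hr] at h2
  have h3 : (η - β * Complex.I : ℂ).re = η := by simp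
  rw [h3]
  calc _ ≤ Real.exp (-(η * r)) * (|α - β| * r) := by gcongr
    _ = _ := by ring

theorem integrableOn_cpow_mul_sub (γ : ℝ) {η : ℝ} (hη : 0 < η) (α β : ℝ) :
    IntegrableOn (fun r : ℝ => (r : ℂ) ^ (-(2 * γ * Complex.I) - 1 : ℂ) *
      (Complex.exp (-((η - α * Complex.I) * r)) - Complex.exp (-((η - β * Complex.I) * r))))
      (Set.Ioi 0) := by
  refine Integrable.mono' (g := fun r => |α - β| * Real.exp (-(η * r))) ?_ ?_ ?_
  · exact (integrableOn_exp_neg_mul hη).const_mul _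
  · exact ((measurable_ofReal_cpow _).mul (by fun_prop)).aestronglyMeasurable
  · refine (ae_restrict_mem measurableSet_Ioi).mono fun r hr => ?_
    have hr : 0 < r := hr
    rw [norm_mul, Complex.norm_cpow_eq_rpow_re_of_pos hr]
    have h := norm_cexp_sub_cexp_le η α β hr.le
    have h1 : (-(2 * γ * Complex.I) - 1 : ℂ).re = -1 := by simp
    rw [h1, Real.rpow_neg_one]
    calc _ ≤ r⁻¹ * (|α - β| * (r * Real.exp (-(η * r)))) := by gcongr
      _ = _ := by field_simp

theorem integral_cpow_mul_sub (γ : ℝ) {η : ℝ} (hη : 0 < η) (α β : ℝ) :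
    (2 * γ * Complex.I) * ∫ r in Set.Ioi (0:ℝ), (r : ℂ) ^ (-(2 * γ * Complex.I) - 1 : ℂ) *
      (Complex.exp (-((η - α * Complex.I) * r)) - Complex.exp (-((η - β * Complex.I) * r))) =
    Complex.Gamma (1 - 2 * γ * Complex.I) *
      ((η - β * Complex.I) ^ (2 * γ * Complex.I : ℂ) -
        (η - α * Complex.I) ^ (2 * γ * Complex.I : ℂ)) := by
  rcases eq_or_ne γ 0 with rfl | hγ
  · simp
  set a : ℂ := η - α * Complex.I with ha
  set b : ℂ := η - β * Complex.I with hb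
  have hare : 0 < a.re := by simpa [ha] using hη
  have hbre : 0 < b.re := by simpa [hb] using hη
  have ha0 : a ≠ 0 := by intro h; simp [h] at hare
  have hb0 : b ≠ 0 := by intro h; simp [h] at hbre
  set w : ℂ := -(2 * γ * Complex.I) with hw
  have hw0 : w ≠ 0 := by simp [hw, hγ, Complex.I_ne_zero]
  have hwn : ∀ r : ℝ, 0 < r → ‖(r : ℂ) ^ w‖ = 1 := fun r hr => norm_ofReal_cpow_I hr γ
  have hIa := integrableOn_cpow_mul_cexp_neg γ hare
  have hIb := integrableOn_cpow_mul_cexp_neg γ hbre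
  have hG : ∀ c : ℂ, 0 < c.re → c ≠ 0 → ∫ r in Set.Ioi (0:ℝ), (r : ℂ) ^ w * Complex.exp (-(c * r)) =
      c⁻¹ * (c ^ (2 * γ * Complex.I : ℂ) * Complex.Gamma (1 - 2 * γ * Complex.I)) := by
    intro c hc hc0
    rw [integral_cpow_mul_cexp_neg γ hc, neg_sub, Complex.cpow_sub _ _ hc0, Complex.cpow_one]
    ring
  have hbd : ∀ r : ℝ, 0 < r → ‖(r : ℂ) ^ w * (Complex.exp (-(a * r)) - Complex.exp (-(b * r)))‖ ≤
      |α - β| * (r * Real.exp (-(η * r))) := by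
    intro r hr
    rw [norm_mul, hwn r hr, one_mul]
    exact norm_cexp_sub_cexp_le η α β hr.le
  have hder : ∀ c : ℂ, ∀ r : ℝ, HasDerivAt (fun r : ℝ => Complex.exp (-(c * r)))
      (Complex.exp (-(c * r)) * -c) r := by
    intro c r
    have h1 : HasDerivAt (fun r : ℝ => (-(c * r) : ℂ)) (-c : ℂ) r := by
      simpa using ((hasDerivAt_id r).ofReal_comp.const_mul c).fun_neg
    exact h1.cexp
  have key := integral_Ioi_mul_deriv_eq_deriv_mul (a := (0:ℝ)) (a' := (0:ℂ)) (b' := 0)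
    (u := fun r : ℝ => (r : ℂ) ^ w) (u' := fun r : ℝ => w * (r : ℂ) ^ (w - 1))
    (v := fun r : ℝ => Complex.exp (-(a * r)) - Complex.exp (-(b * r)))
    (v' := fun r : ℝ => Complex.exp (-(a * r)) * -a - Complex.exp (-(b * r)) * -b)
    (fun r hr => hasDerivAt_ofReal_cpow_const (ne_of_gt hr) hw0)
    (fun r hr => (hder a r).sub (hder b r)) ?_ ?_ ?_ ?_
  · simp only [sub_zero, zero_sub, mul_assoc] at key
    rw [integral_const_mul] at key
    have h2 : ∫ r in Set.Ioi (0:ℝ), (r : ℂ) ^ w * (Complex.exp (-(a * r)) * -a -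
        Complex.exp (-(b * r)) * -b) = b * (∫ r in Set.Ioi (0:ℝ), (r : ℂ) ^ w *
        Complex.exp (-(b * r))) - a * (∫ r in Set.Ioi (0:ℝ), (r : ℂ) ^ w *
        Complex.exp (-(a * r))) := by
      rw [← integral_const_mul, ← integral_const_mul,
        ← integral_sub (hIb.const_mul b) (hIa.const_mul a)]
      congr 1; ext r; ring
    rw [h2, hG a hare ha0, hG b hbre hb0, mul_inv_cancel_left₀ ha0, mul_inv_cancel_left₀ hb0] at key
    have hw' : 2 * γ * Complex.I = -w := by rw [hw, neg_neg]
    rw [hw', neg_mul, ← key, ← hw']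
    ring
  · refine ((hIb.const_mul b).sub (hIa.const_mul a)).congr (Filter.Eventually.of_forall fun r => ?_)
    simp only [Pi.mul_apply, Pi.sub_apply]
    ring
  · refine ((integrableOn_cpow_mul_sub γ hη α β).const_mul w).congr
      (Filter.Eventually.of_forall fun r => ?_)
    simp only [Pi.mul_apply, ← hw, ← ha, ← hb]
    ring
  · refine squeeze_zero_norm' (a := fun r : ℝ => |α - β| * (r * Real.exp (-(η * r)))) ?_ ?_
    · filter_upwards [self_mem_nhdsWithin] with r hr using hbd r hr
    · refine Filter.Tendsto.mono_left ?_ nhdsWithin_le_nhds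
      have : Continuous fun r : ℝ => |α - β| * (r * Real.exp (-(η * r))) := by fun_prop
      simpa using this.tendsto 0
  · refine squeeze_zero_norm' (a := fun r : ℝ => |α - β| * (r * Real.exp (-(η * r)))) ?_ ?_
    · filter_upwards [Filter.eventually_gt_atTop 0] with r hr using hbd r hr
    · have h := tendsto_rpow_mul_exp_neg_mul_atTop_nhds_zero 1 η hη
      simpa using h.const_mul |α - β|

end OscillatoryKernel

section KernelBound

theorem norm_cpow_sub_cpow_le (γ : ℝ) {η : ℝ} (hη : 0 < η) {y α β : ℝ} (hy : 0 < y) (hα : y ≤ α)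
    (hβ : y ≤ β) :
    ‖(η - β * Complex.I) ^ (2 * γ * Complex.I : ℂ) - (η - α * Complex.I) ^ (2 * γ * Complex.I : ℂ)‖
      ≤ 2 * |γ| * Real.exp (Real.pi * |γ|) / y * |α - β| := by
  have hder : ∀ s ∈ Set.Ici y, HasDerivWithinAt
      (fun s : ℝ => (η - s * Complex.I : ℂ) ^ (2 * γ * Complex.I : ℂ))
      ((2 * γ * Complex.I) * (η - s * Complex.I) ^ (2 * γ * Complex.I - 1 : ℂ) * -Complex.I)
      (Set.Ici y) s := by
    intro s _
    have h1 : HasDerivAt (fun s : ℝ => (η - s * Complex.I : ℂ)) (-Complex.I) s := by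
      simpa using ((hasDerivAt_id s).ofReal_comp.mul_const Complex.I).const_sub (η : ℂ)
    have h2 : HasDerivAt (fun c : ℂ => c ^ (2 * γ * Complex.I : ℂ))
        ((2 * γ * Complex.I) * (η - s * Complex.I) ^ (2 * γ * Complex.I - 1 : ℂ))
        (η - s * Complex.I) := by
      simpa using (hasDerivAt_id (η - s * Complex.I : ℂ)).cpow_const
        (c := 2 * γ * Complex.I) (Or.inl (by simpa using hη))
    exact (h2.comp s h1).hasDerivWithinAt
  have := Convex.norm_image_sub_le_of_norm_hasDerivWithin_le (x := α) (y := β) hder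
    (C := 2 * |γ| * Real.exp (Real.pi * |γ|) / y) ?_ (convex_Ici y) hα hβ
  · rwa [Real.norm_eq_abs, abs_sub_comm] at this
  · intro s hs
    have hs : y ≤ s := hs
    have hre : 0 < (η - s * Complex.I : ℂ).re := by simpa using hη
    have h0 : (η - s * Complex.I : ℂ) ≠ 0 := by intro h; simp [h] at hre
    have hn : y ≤ ‖(η - s * Complex.I : ℂ)‖ := by
      refine hs.trans ((le_abs_self s).trans ?_)
      have := Complex.abs_im_le_norm (η - s * Complex.I : ℂ)
      simpa using this
    rw [Complex.cpow_sub _ _ h0, Complex.cpow_one, norm_mul, norm_mul, norm_div, norm_neg,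
      Complex.norm_I, mul_one]
    have h2 : ‖(2 * γ * Complex.I : ℂ)‖ = 2 * |γ| := by simp
    rw [h2, mul_div_assoc]
    gcongr
    exact norm_cpow_le_of_re_pos hre γ

theorem fourierInv_cpow_mul_exp (t η γ : ℝ) {x : EuclideanSpace ℝ (Fin 3)}
    (hx : x ≠ 0)
    (hi : Integrable fun ξ : EuclideanSpace ℝ (Fin 3) => (‖ξ‖ : ℂ) ^ (-(2 * (1 + γ * Complex.I))) *
      (Complex.exp (2 * Real.pi * Complex.I * (t * ‖ξ‖ : ℝ)) * (Real.exp (-(η * ‖ξ‖)) : ℝ))) :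
    𝓕⁻ (fun ξ : EuclideanSpace ℝ (Fin 3) => (‖ξ‖ : ℂ) ^ (-(2 * (1 + γ * Complex.I))) *
      (Complex.exp (2 * Real.pi * Complex.I * (t * ‖ξ‖ : ℝ)) * (Real.exp (-(η * ‖ξ‖)) : ℝ))) x =
    (∫ r in Set.Ioi (0:ℝ), (r : ℂ) ^ (-(2 * γ * Complex.I) - 1 : ℂ) *
      (Complex.exp (-((η - (2 * Real.pi * (t + ‖x‖) : ℝ) * Complex.I) * r)) -
        Complex.exp (-((η - (2 * Real.pi * (t - ‖x‖) : ℝ) * Complex.I) * r)))) /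
      (Complex.I * ‖x‖) := by
  have h := fourierInv_radial (m := fun r : ℝ => (r : ℂ) ^ (-(2 * (1 + γ * Complex.I))) *
      (Complex.exp (2 * Real.pi * Complex.I * (t * r : ℝ)) * (Real.exp (-(η * r)) : ℝ)))
      ((measurable_ofReal_cpow _).mul (by fun_prop)) hi hx
  rw [h]
  congr 1
  refine setIntegral_congr_fun measurableSet_Ioi fun r hr => ?_
  have hr0 : (r : ℂ) ≠ 0 := by exact_mod_cast (ne_of_gt hr : r ≠ 0)
  have h1 : (r : ℂ) ^ (-(2 * γ * Complex.I) - 1 : ℂ) =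
      r * (r : ℂ) ^ (-(2 * (1 + γ * Complex.I))) := by
    rw [show (-(2 * γ * Complex.I) - 1 : ℂ) = 1 + -(2 * (1 + γ * Complex.I)) by ring,
      Complex.cpow_add _ _ hr0, Complex.cpow_one]
  have h2 : Complex.exp (-((η - (2 * Real.pi * (t + ‖x‖) : ℝ) * Complex.I) * r)) =
      Complex.exp (2 * Real.pi * Complex.I * (t * r : ℝ)) * (Real.exp (-(η * r)) : ℝ) *
        Complex.exp (Complex.I * (2 * Real.pi * ‖x‖ * r : ℝ)) := by
    rw [Complex.ofReal_exp, ← Complex.exp_add, ← Complex.exp_add]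
    congr 1; push_cast; ring
  have h3 : Complex.exp (-((η - (2 * Real.pi * (t - ‖x‖) : ℝ) * Complex.I) * r)) =
      Complex.exp (2 * Real.pi * Complex.I * (t * r : ℝ)) * (Real.exp (-(η * r)) : ℝ) *
        Complex.exp (-(Complex.I * (2 * Real.pi * ‖x‖ * r : ℝ))) := by
    rw [Complex.ofReal_exp, ← Complex.exp_add, ← Complex.exp_add]
    congr 1; push_cast; ring
  simp only [h1, h2, h3]
  ring

theorem norm_fourierInv_cpow_mul_exp_le {t η : ℝ} (ht : 0 < t) (hη : 0 < η) (γ : ℝ)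
    {x : EuclideanSpace ℝ (Fin 3)} (hx : x ≠ 0)
    (hi : Integrable fun ξ : EuclideanSpace ℝ (Fin 3) => (‖ξ‖ : ℂ) ^ (-(2 * (1 + γ * Complex.I))) *
      (Complex.exp (2 * Real.pi * Complex.I * (t * ‖ξ‖ : ℝ)) * (Real.exp (-(η * ‖ξ‖)) : ℝ))) :
    |γ| * ‖𝓕⁻ (fun ξ : EuclideanSpace ℝ (Fin 3) => (‖ξ‖ : ℂ) ^ (-(2 * (1 + γ * Complex.I))) *
      (Complex.exp (2 * Real.pi * Complex.I * (t * ‖ξ‖ : ℝ)) * (Real.exp (-(η * ‖ξ‖)) : ℝ))) x‖ ≤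
    (4 * |γ| + 2) * Real.exp (Real.pi * |γ|) / t := by
  have hρ : 0 < ‖x‖ := norm_pos_iff.2 hx
  rw [fourierInv_cpow_mul_exp t η γ hx hi, norm_div]
  have hkey := integral_cpow_mul_sub γ hη (2 * Real.pi * (t + ‖x‖)) (2 * Real.pi * (t - ‖x‖))
  have hnorm := congrArg norm hkey
  rw [norm_mul, norm_mul (Complex.Gamma _)] at hnorm
  have h2 : ‖(2 * γ * Complex.I : ℂ)‖ = 2 * |γ| := by simp
  have h3 : ‖(Complex.I * ‖x‖ : ℂ)‖ = ‖x‖ := by simp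
  rw [h2] at hnorm
  rw [h3]
  set J := ‖∫ r in Set.Ioi (0:ℝ), (r : ℂ) ^ (-(2 * γ * Complex.I) - 1 : ℂ) *
      (Complex.exp (-((η - (2 * Real.pi * (t + ‖x‖) : ℝ) * Complex.I) * r)) -
        Complex.exp (-((η - (2 * Real.pi * (t - ‖x‖) : ℝ) * Complex.I) * r)))‖
  set Dn := ‖(η - (2 * Real.pi * (t - ‖x‖) : ℝ) * Complex.I) ^ (2 * γ * Complex.I : ℂ) -
      (η - (2 * Real.pi * (t + ‖x‖) : ℝ) * Complex.I) ^ (2 * γ * Complex.I : ℂ)‖ with hDn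
  have hle : 2 * |γ| * J ≤ Dn := by
    rw [hnorm]
    exact mul_le_of_le_one_left (norm_nonneg _) (norm_Gamma_one_sub_le γ)
  have hπ := Real.pi_pos
  set e := Real.exp (Real.pi * |γ|) with he
  have he0 : 0 < e := Real.exp_pos _
  have hγ0 := abs_nonneg γ
  rw [← mul_div_assoc, div_le_div_iff₀ hρ ht]
  rcases le_or_gt ‖x‖ (t / 2) with hc | hc
  · have hD : Dn ≤ 2 * |γ| * e / (Real.pi * t) *
        |2 * Real.pi * (t + ‖x‖) - 2 * Real.pi * (t - ‖x‖)| :=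
      norm_cpow_sub_cpow_le γ hη (by positivity) (by nlinarith) (by nlinarith)
    rw [show 2 * Real.pi * (t + ‖x‖) - 2 * Real.pi * (t - ‖x‖) = 4 * Real.pi * ‖x‖ by ring,
      abs_of_nonneg (show 0 ≤ 4 * Real.pi * ‖x‖ by positivity)] at hD
    have hD' : Dn * t ≤ 8 * |γ| * e * ‖x‖ := by
      calc Dn * t ≤ 2 * |γ| * e / (Real.pi * t) * (4 * Real.pi * ‖x‖) * t := by gcongr
        _ = _ := by field_simp; ring
    have h5 : 2 * |γ| * J * t ≤ 8 * |γ| * e * ‖x‖ :=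
      (mul_le_mul_of_nonneg_right hle ht.le).trans hD'
    have h6 : 0 ≤ e * ‖x‖ := by positivity
    nlinarith
  · have hD : Dn ≤ e + e := by
      refine (norm_sub_le _ _).trans (add_le_add ?_ ?_) <;>
      exact norm_cpow_le_of_re_pos (by simpa using hη) γ
    have h5 : |γ| * J * t ≤ e * t := by
      have : |γ| * J ≤ e := by linarith
      gcongr
    have h6 : e * t ≤ e * (2 * ‖x‖) := by gcongr; linarith
    have h7 : 0 ≤ |γ| * e * ‖x‖ := by positivity
    nlinarith

end KernelBound

section Symbol

/-- The symbol `r ^ (-2z) e^{2πitr}`, damped at infinity by `e^{-εr}` and at the origin by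
`(1 - e^{-δr})³`. -/
noncomputable def dampedSymbol (t ε δ : ℝ) (z : ℂ) (r : ℝ) : ℂ :=
  (r : ℂ) ^ (-(2 * z)) * (Complex.exp (2 * Real.pi * Complex.I * (t * r : ℝ)) *
    (Real.exp (-(ε * r)) * (1 - Real.exp (-(δ * r))) ^ 3 : ℝ))

theorem measurable_dampedSymbol (t ε δ : ℝ) (z : ℂ) : Measurable (dampedSymbol t ε δ z) :=
  (measurable_ofReal_cpow _).mul (by fun_prop)

theorem integrable_cpow_mul_exp (t γ : ℝ) {η : ℝ} (hη : 0 < η) :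
    Integrable fun ξ : EuclideanSpace ℝ (Fin 3) => (‖ξ‖ : ℂ) ^ (-(2 * (1 + γ * Complex.I))) *
      (Complex.exp (2 * Real.pi * Complex.I * (t * ‖ξ‖ : ℝ)) * (Real.exp (-(η * ‖ξ‖)) : ℝ)) := by
  refine (integrable_fun_norm_addHaar volume (f := fun r : ℝ => (r : ℂ) ^ (-(2 * (1 + γ * Complex.I)))
    * (Complex.exp (2 * Real.pi * Complex.I * (t * r : ℝ)) * (Real.exp (-(η * r)) : ℝ)))).2 ?_
  refine Integrable.mono' (integrableOn_exp_neg_mul hη) ?_ ?_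
  · exact (Measurable.smul (f := fun r : ℝ => r ^ (_ : ℕ)) (measurable_id.pow_const _)
      ((measurable_ofReal_cpow _).mul (by fun_prop))).aestronglyMeasurable
  · refine (ae_restrict_mem measurableSet_Ioi).mono fun r hr => ?_
    have hr : 0 < r := hr
    rw [norm_smul, norm_mul, norm_mul, Complex.norm_cpow_eq_rpow_re_of_pos hr]
    have h1 : (-(2 * (1 + γ * Complex.I)) : ℂ).re = -2 := by simp
    have h2 : ‖Complex.exp (2 * Real.pi * Complex.I * (t * r : ℝ))‖ = 1 := by
      rw [Complex.norm_exp]; simp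
    have h3 : r ^ (-2 : ℝ) = (r ^ 2)⁻¹ := by
      rw [Real.rpow_neg hr.le]; norm_cast
    rw [h1, h2, h3, Complex.norm_real, Real.norm_eq_abs (Real.exp _),
      Real.abs_exp, finrank_euclideanSpace_fin]
    simp only [norm_pow, Real.norm_eq_abs, sq_abs, Nat.add_one_sub_one, one_mul]
    rw [mul_inv_cancel_left₀ (by positivity)]

theorem dampedSymbol_one_add_eq (t ε δ γ r : ℝ) :
    dampedSymbol t ε δ (1 + γ * Complex.I) r = ∑ j ∈ Finset.range 4, ((-1) ^ j * (Nat.choose 3 j) : ℂ) *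
      ((r : ℂ) ^ (-(2 * (1 + γ * Complex.I))) *
      (Complex.exp (2 * Real.pi * Complex.I * (t * r : ℝ)) *
        (Real.exp (-((ε + j * δ) * r)) : ℝ))) := by
  have h : ∀ j : ℕ, Real.exp (-((ε + j * δ) * r)) = Real.exp (-(ε * r)) * Real.exp (-(δ * r)) ^ j := by
    intro j
    rw [← Real.exp_nat_mul, ← Real.exp_add]
    congr 1; ring
  simp only [h, dampedSymbol, Finset.sum_range_succ, Finset.sum_range_zero]
  simp [Nat.choose]
  ring

theorem integrable_dampedSymbol_one_add (t γ : ℝ) {ε δ : ℝ} (hε : 0 < ε) (hδ : 0 < δ) :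
    Integrable fun ξ : EuclideanSpace ℝ (Fin 3) => dampedSymbol t ε δ (1 + γ * Complex.I) ‖ξ‖ := by
  simp only [dampedSymbol_one_add_eq]
  refine integrable_finsetSum _ fun j _ => ?_
  exact (integrable_cpow_mul_exp t γ (by positivity)).const_mul _

theorem norm_fourierInv_dampedSymbol_le {t ε δ : ℝ} (ht : 0 < t) (hε : 0 < ε) (hδ : 0 < δ) (γ : ℝ)
    {x : EuclideanSpace ℝ (Fin 3)} (hx : x ≠ 0) :
    |γ| * ‖𝓕⁻ (fun ξ : EuclideanSpace ℝ (Fin 3) =>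
      dampedSymbol t ε δ (1 + γ * Complex.I) ‖ξ‖) x‖ ≤
      8 * ((4 * |γ| + 2) * Real.exp (Real.pi * |γ|) / t) := by
  have hη : ∀ j : ℕ, 0 < ε + j * δ := fun j => by positivity
  have h : 𝓕⁻ (fun ξ : EuclideanSpace ℝ (Fin 3) =>
      dampedSymbol t ε δ (1 + γ * Complex.I) ‖ξ‖) x =
      ∑ j ∈ Finset.range 4, ((-1) ^ j * (Nat.choose 3 j) : ℂ) *
      𝓕⁻ (fun ξ : EuclideanSpace ℝ (Fin 3) => (‖ξ‖ : ℂ) ^ (-(2 * (1 + γ * Complex.I))) *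
      (Complex.exp (2 * Real.pi * Complex.I * (t * ‖ξ‖ : ℝ)) *
        (Real.exp (-((ε + j * δ) * ‖ξ‖)) : ℝ))) x := by
    simp only [Real.fourierInv_eq', dampedSymbol_one_add_eq, smul_eq_mul, Finset.mul_sum]
    rw [integral_finsetSum]
    · refine Finset.sum_congr rfl fun j _ => ?_
      rw [← integral_const_mul]
      congr 1; ext v; ring
    · intro j _
      have := (integrable_cpow_mul_exp t γ (hη j)).const_mul ((-1) ^ j * (Nat.choose 3 j) : ℂ)
      refine this.bdd_mul (c := 1) (by fun_prop) (Filter.Eventually.of_forall fun v => ?_)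
      rw [Complex.norm_exp]; simp
  rw [h]
  set K := (4 * |γ| + 2) * Real.exp (Real.pi * |γ|) / t
  calc _ ≤ |γ| * ∑ j ∈ Finset.range 4, ‖((-1) ^ j * (Nat.choose 3 j) : ℂ) * _‖ := by
        gcongr; exact norm_sum_le _ _
    _ = ∑ j ∈ Finset.range 4, (Nat.choose 3 j : ℝ) * (|γ| * ‖𝓕⁻ (fun ξ : EuclideanSpace ℝ (Fin 3) =>
      (‖ξ‖ : ℂ) ^ (-(2 * (1 + γ * Complex.I))) *
      (Complex.exp (2 * Real.pi * Complex.I * (t * ‖ξ‖ : ℝ)) *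
        (Real.exp (-((ε + j * δ) * ‖ξ‖)) : ℝ))) x‖) := by
        rw [Finset.mul_sum]
        refine Finset.sum_congr rfl fun j _ => ?_
        simp only [norm_mul, norm_pow, norm_neg, norm_one, one_pow, one_mul, Complex.norm_natCast]
        ring
    _ ≤ ∑ j ∈ Finset.range 4, (Nat.choose 3 j : ℝ) * K := by
        gcongr with j _
        exact norm_fourierInv_cpow_mul_exp_le ht (hη j) γ hx (integrable_cpow_mul_exp t γ (hη j))
    _ = 8 * K := by
        simp [Finset.sum_range_succ, Nat.choose]; ring

end Symbol

section SymbolBounds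

theorem norm_dampedSymbol {t ε δ : ℝ} (hδ : 0 < δ) (z : ℂ) {r : ℝ} (hr : 0 < r) :
    ‖dampedSymbol t ε δ z r‖ =
      r ^ (-(2 * z.re)) * (Real.exp (-(ε * r)) * (1 - Real.exp (-(δ * r))) ^ 3) := by
  have h2 : ‖Complex.exp (2 * Real.pi * Complex.I * (t * r : ℝ))‖ = 1 := by
    rw [Complex.norm_exp]; simp
  have h3 : 0 ≤ 1 - Real.exp (-(δ * r)) := by
    rw [sub_nonneg, Real.exp_le_one_iff]
    nlinarith
  rw [dampedSymbol, norm_mul, norm_mul, h2, one_mul, Complex.norm_cpow_eq_rpow_re_of_pos hr,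
    Complex.norm_real, Real.norm_of_nonneg (by positivity)]
  simp

theorem dampedSymbol_zero (t ε δ : ℝ) (z : ℂ) : dampedSymbol t ε δ z 0 = 0 := by
  simp [dampedSymbol]

theorem one_sub_exp_neg_mem_Icc {x : ℝ} (hx : 0 ≤ x) :
    0 ≤ 1 - Real.exp (-x) ∧ 1 - Real.exp (-x) ≤ 1 ∧ 1 - Real.exp (-x) ≤ x := by
  refine ⟨?_, ?_, ?_⟩
  · rw [sub_nonneg, Real.exp_le_one_iff]; linarith
  · linarith [Real.exp_pos (-x)]
  · linarith [Real.add_one_le_exp (-x)]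

theorem rpow_neg_two_mul_le {r σ : ℝ} (hr : 0 < r) (h0 : 0 ≤ σ) (h1 : σ ≤ 1) :
    r ^ (-(2 * σ)) ≤ 1 + (r ^ 2)⁻¹ := by
  rcases le_total 1 r with h | h
  · have := Real.rpow_le_one_of_one_le_of_nonpos h (show -(2 * σ) ≤ 0 by linarith)
    have h2 : 0 < (r ^ 2)⁻¹ := by positivity
    linarith
  · have := Real.rpow_le_rpow_of_exponent_ge hr h (show (-2 : ℝ) ≤ -(2 * σ) by linarith)
    have h3 : r ^ (-2 : ℝ) = (r ^ 2)⁻¹ := by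
      rw [Real.rpow_neg hr.le]; norm_cast
    linarith

theorem norm_dampedSymbol_le_one {t ε δ : ℝ} (hε : 0 < ε) (hδ : 0 < δ) {z : ℂ} (hz : z.re = 0) {r : ℝ}
    (hr : 0 ≤ r) : ‖dampedSymbol t ε δ z r‖ ≤ 1 := by
  rcases hr.eq_or_lt with rfl | hr
  · simp [dampedSymbol_zero]
  obtain ⟨h0, h1, -⟩ := one_sub_exp_neg_mem_Icc (mul_nonneg hδ.le hr.le)
  rw [norm_dampedSymbol hδ z hr, hz]
  simp only [mul_zero, neg_zero, Real.rpow_zero, one_mul]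
  refine mul_le_one₀ ?_ (by positivity) (pow_le_one₀ h0 h1)
  rw [Real.exp_le_one_iff]
  nlinarith

theorem norm_dampedSymbol_le {t ε δ : ℝ} (hδ : 0 < δ) {z : ℂ} (hz0 : 0 ≤ z.re) (hz1 : z.re ≤ 1)
    {r : ℝ} (hr : 0 ≤ r) : ‖dampedSymbol t ε δ z r‖ ≤ (1 + δ ^ 2) * Real.exp (-(ε * r)) := by
  rcases hr.eq_or_lt with rfl | hr
  · rw [dampedSymbol_zero, norm_zero]; positivity
  obtain ⟨h0, h1, h2⟩ := one_sub_exp_neg_mem_Icc (mul_nonneg hδ.le hr.le)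
  rw [norm_dampedSymbol hδ z hr]
  set u := 1 - Real.exp (-(δ * r))
  have hu3 : u ^ 3 ≤ 1 := pow_le_one₀ h0 h1
  have hu2 : u ^ 3 ≤ (δ * r) ^ 2 := by
    calc u ^ 3 = u ^ 2 * u := by ring
      _ ≤ u ^ 2 * 1 := by gcongr
      _ ≤ (δ * r) ^ 2 := by rw [mul_one]; gcongr
  calc _ ≤ (1 + (r ^ 2)⁻¹) * (Real.exp (-(ε * r)) * u ^ 3) := by
        gcongr; exact rpow_neg_two_mul_le hr hz0 hz1
    _ = (u ^ 3 + (r ^ 2)⁻¹ * u ^ 3) * Real.exp (-(ε * r)) := by ring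
    _ ≤ (1 + (r ^ 2)⁻¹ * (δ * r) ^ 2) * Real.exp (-(ε * r)) := by gcongr
    _ = _ := by field_simp

theorem abs_log_le_add_inv {r : ℝ} (hr : 0 < r) : |Real.log r| ≤ r + r⁻¹ := by
  have h1 := Real.log_le_sub_one_of_pos hr
  have h2 := Real.log_le_sub_one_of_pos (inv_pos.2 hr)
  rw [Real.log_inv] at h2
  have := inv_pos.2 hr
  rw [abs_le]; constructor <;> linarith

theorem hasDerivAt_dampedSymbol (t ε δ : ℝ) (z : ℂ) {r : ℝ} (hr : 0 ≤ r) :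
    HasDerivAt (fun z => dampedSymbol t ε δ z r)
      (-(2 * Real.log r : ℝ) * dampedSymbol t ε δ z r) z := by
  rcases hr.eq_or_lt with rfl | hr
  · simpa [dampedSymbol_zero] using hasDerivAt_const z (0:ℂ)
  have hr0 : (r : ℂ) ≠ 0 := by exact_mod_cast hr.ne'
  have h1 : HasDerivAt (fun z : ℂ => -(2 * z)) (-2) z := by
    simpa using ((hasDerivAt_id z).const_mul 2).fun_neg
  have h2 := (h1.const_cpow (c := (r : ℂ)) (Or.inl hr0)).mul_const
    (Complex.exp (2 * Real.pi * Complex.I * (t * r : ℝ)) *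
    (Real.exp (-(ε * r)) * (1 - Real.exp (-(δ * r))) ^ 3 : ℝ))
  refine h2.congr_deriv ?_
  rw [dampedSymbol, ← Complex.ofReal_log hr.le]
  push_cast; ring

theorem norm_deriv_dampedSymbol_le {t ε δ : ℝ} (hδ : 0 < δ) {z : ℂ} (hz0 : 0 ≤ z.re)
    (hz1 : z.re ≤ 1) {r : ℝ} (hr : 0 ≤ r) :
    ‖-(2 * Real.log r : ℝ) * dampedSymbol t ε δ z r‖ ≤
      2 * ((r + (2 * δ + δ ^ 3)) * Real.exp (-(ε * r))) := by
  rcases hr.eq_or_lt with rfl | hr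
  · rw [dampedSymbol_zero, mul_zero, norm_zero]; positivity
  obtain ⟨h0, h1, h2⟩ := one_sub_exp_neg_mem_Icc (mul_nonneg hδ.le hr.le)
  rw [norm_mul, norm_dampedSymbol hδ z hr, norm_neg, Complex.norm_real, norm_mul, Real.norm_ofNat,
    Real.norm_eq_abs, mul_assoc]
  set u := 1 - Real.exp (-(δ * r))
  have hu0 : u ^ 3 ≤ 1 := pow_le_one₀ h0 h1
  have hu1 : u ^ 3 ≤ δ * r := by
    calc u ^ 3 = u ^ 2 * u := by ring
      _ ≤ 1 * u := by gcongr; exact pow_le_one₀ h0 h1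
      _ ≤ _ := by linarith
  have hu3 : u ^ 3 ≤ (δ * r) ^ 3 := by gcongr
  refine mul_le_mul_of_nonneg_left ?_ zero_le_two
  calc _ ≤ (r + r⁻¹) * ((1 + (r ^ 2)⁻¹) * (Real.exp (-(ε * r)) * u ^ 3)) := by
        gcongr
        · exact abs_log_le_add_inv hr
        · exact rpow_neg_two_mul_le hr hz0 hz1
    _ = (r * u ^ 3 + 2 * (r⁻¹ * u ^ 3) + (r ^ 3)⁻¹ * u ^ 3) * Real.exp (-(ε * r)) := by
        field_simp; ring
    _ ≤ (r * 1 + 2 * (r⁻¹ * (δ * r)) + (r ^ 3)⁻¹ * (δ * r) ^ 3) * Real.exp (-(ε * r)) := by gcongr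
    _ = _ := by field_simp; ring

theorem integrable_norm_pow_mul_exp_neg {ε : ℝ} (hε : 0 < ε) (n : ℕ) :
    Integrable fun ξ : EuclideanSpace ℝ (Fin 3) => ‖ξ‖ ^ n * Real.exp (-(ε * ‖ξ‖)) := by
  refine (integrable_fun_norm_addHaar volume
    (f := fun r : ℝ => r ^ n * Real.exp (-(ε * r)))).2 ?_
  have h := integrableOn_rpow_mul_exp_neg_mul_rpow (p := 1) (s := (n + 2 : ℕ)) (b := ε)
    (by push_cast; linarith [(Nat.cast_nonneg n : (0:ℝ) ≤ n)]) one_pos hε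
  refine h.congr_fun (fun r _ => ?_) measurableSet_Ioi
  simp only [Real.rpow_natCast, Real.rpow_one, finrank_euclideanSpace_fin, smul_eq_mul]
  rw [pow_add, neg_mul]
  simp only [Nat.add_one_sub_one]; ring

variable {ψ : EuclideanSpace ℝ (Fin 3) → ℂ} {K : ℝ}

theorem measurable_dampedSymbol_norm (t ε δ : ℝ) (z : ℂ) :
    Measurable fun ξ : EuclideanSpace ℝ (Fin 3) => dampedSymbol t ε δ z ‖ξ‖ :=
  (measurable_dampedSymbol t ε δ z).comp measurable_norm

theorem norm_dampedSymbol_mul_le {t ε δ : ℝ} (hδ : 0 < δ) (hK : ∀ ξ, ‖ψ ξ‖ ≤ K) {z : ℂ}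
    (hz0 : 0 ≤ z.re) (hz1 : z.re ≤ 1) (ξ : EuclideanSpace ℝ (Fin 3)) :
    ‖dampedSymbol t ε δ z ‖ξ‖ * ψ ξ‖ ≤ (1 + δ ^ 2) * K * Real.exp (-(ε * ‖ξ‖)) := by
  rw [norm_mul]
  calc _ ≤ (1 + δ ^ 2) * Real.exp (-(ε * ‖ξ‖)) * K := by
        gcongr
        · exact norm_dampedSymbol_le hδ hz0 hz1 (norm_nonneg _)
        · exact hK ξ
    _ = _ := by ring

theorem integrable_dampedSymbol_mul {t ε δ : ℝ} (hε : 0 < ε) (hδ : 0 < δ)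
    (hψ : AEStronglyMeasurable ψ) (hK : ∀ ξ, ‖ψ ξ‖ ≤ K) {z : ℂ}
    (hz0 : 0 ≤ z.re) (hz1 : z.re ≤ 1) :
    Integrable fun ξ => dampedSymbol t ε δ z ‖ξ‖ * ψ ξ := by
  refine Integrable.mono' (g := fun ξ => (1 + δ ^ 2) * K * Real.exp (-(ε * ‖ξ‖))) ?_ ?_ ?_
  · simpa using (integrable_norm_pow_mul_exp_neg hε 0).const_mul ((1 + δ ^ 2) * K)
  · exact (measurable_dampedSymbol_norm t ε δ z).aestronglyMeasurable.mul hψ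
  · exact Filter.Eventually.of_forall fun ξ => norm_dampedSymbol_mul_le hδ hK hz0 hz1 ξ

theorem norm_integral_dampedSymbol_mul_le {t ε δ : ℝ} (hε : 0 < ε) (hδ : 0 < δ)
    (hK : ∀ ξ, ‖ψ ξ‖ ≤ K) {z : ℂ} (hz0 : 0 ≤ z.re) (hz1 : z.re ≤ 1) :
    ‖∫ ξ, dampedSymbol t ε δ z ‖ξ‖ * ψ ξ‖ ≤
      ∫ ξ : EuclideanSpace ℝ (Fin 3), (1 + δ ^ 2) * K * Real.exp (-(ε * ‖ξ‖)) := by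
  refine norm_integral_le_of_norm_le ?_ (Filter.Eventually.of_forall fun ξ =>
    norm_dampedSymbol_mul_le hδ hK hz0 hz1 ξ)
  simpa using (integrable_norm_pow_mul_exp_neg hε 0).const_mul ((1 + δ ^ 2) * K)

theorem diffContOnCl_integral_dampedSymbol_mul {t ε δ : ℝ} (hε : 0 < ε) (hδ : 0 < δ)
    (hψ : AEStronglyMeasurable ψ) (hK : ∀ ξ, ‖ψ ξ‖ ≤ K) :
    DiffContOnCl ℂ (fun z => ∫ ξ, dampedSymbol t ε δ z ‖ξ‖ * ψ ξ)
      (Complex.HadamardThreeLines.verticalStrip 0 1) := by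
  have hopen : IsOpen (Complex.HadamardThreeLines.verticalStrip 0 1) :=
    isOpen_Ioo.preimage Complex.continuous_re
  have hcl : closure (Complex.HadamardThreeLines.verticalStrip 0 1) ⊆ Complex.re ⁻¹' Set.Icc 0 1 :=
    closure_minimal (Set.preimage_mono Set.Ioo_subset_Icc_self)
      (isClosed_Icc.preimage Complex.continuous_re)
  constructor
  · intro z hz
    refine DifferentiableAt.differentiableWithinAt (HasDerivAt.differentiableAt
      (hasDerivAt_integral_of_dominated_loc_of_deriv_le
      (s := Complex.HadamardThreeLines.verticalStrip 0 1)
      (bound := fun ξ => 2 * ((‖ξ‖ + (2 * δ + δ ^ 3)) * Real.exp (-(ε * ‖ξ‖))) * K)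
      (F' := fun z ξ => -(2 * Real.log ‖ξ‖ : ℝ) * dampedSymbol t ε δ z ‖ξ‖ * ψ ξ)
      (hopen.mem_nhds hz) ?_ ?_ ?_ ?_ ?_ ?_).2)
    · exact Filter.Eventually.of_forall fun z =>
        (measurable_dampedSymbol_norm t ε δ z).aestronglyMeasurable.mul hψ
    · exact integrable_dampedSymbol_mul hε hδ hψ hK hz.1.le hz.2.le
    · refine AEStronglyMeasurable.mul (AEStronglyMeasurable.mul ?_
        (measurable_dampedSymbol_norm t ε δ z).aestronglyMeasurable) hψ
      exact Measurable.aestronglyMeasurable (by fun_prop)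
    · refine Filter.Eventually.of_forall fun ξ z hz => ?_
      rw [norm_mul]
      gcongr
      · exact norm_deriv_dampedSymbol_le hδ hz.1.le hz.2.le (norm_nonneg _)
      · exact hK ξ
    · have h0 := (integrable_norm_pow_mul_exp_neg hε 0).const_mul (2 * (2 * δ + δ ^ 3) * K)
      have h1 := (integrable_norm_pow_mul_exp_neg hε 1).const_mul (2 * K)
      refine (h1.add h0).congr (Filter.Eventually.of_forall fun ξ => ?_)
      simp only [Pi.add_apply, pow_one, pow_zero]
      ring
    · exact Filter.Eventually.of_forall fun ξ z _ =>
        (hasDerivAt_dampedSymbol t ε δ z (norm_nonneg ξ)).mul_const _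
  · refine continuousOn_of_dominated (bound := fun ξ => (1 + δ ^ 2) * K * Real.exp (-(ε * ‖ξ‖)))
      ?_ ?_ ?_ ?_
    · exact fun z _ => (measurable_dampedSymbol_norm t ε δ z).aestronglyMeasurable.mul hψ
    · exact fun z hz => Filter.Eventually.of_forall fun ξ =>
        norm_dampedSymbol_mul_le hδ hK (hcl hz).1 (hcl hz).2 ξ
    · simpa using (integrable_norm_pow_mul_exp_neg hε 0).const_mul ((1 + δ ^ 2) * K)
    · exact Filter.Eventually.of_forall fun ξ z _ =>
        ((hasDerivAt_dampedSymbol t ε δ z (norm_nonneg ξ)).mul_const _).continuousAt.continuousWithinAt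

end SymbolBounds

section BilinearForm

theorem enorm_integral_mul_mul_le {α : Type*} [MeasurableSpace α] {μ : Measure α} {M F G : α → ℂ}
    {K : ℝ} (hM : ∀ x, ‖M x‖ ≤ K) (hF : AEStronglyMeasurable F μ) (hG : AEStronglyMeasurable G μ) :
    ‖∫ x, M x * (F x * G x) ∂μ‖ₑ ≤ ENNReal.ofReal K * (eLpNorm F 2 μ * eLpNorm G 2 μ) := by
  calc _ ≤ ∫⁻ x, ‖M x * (F x * G x)‖ₑ ∂μ := enorm_integral_le_lintegral_enorm _
    _ ≤ ∫⁻ x, ENNReal.ofReal K * ‖(F • G) x‖ₑ ∂μ := by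
        refine lintegral_mono fun x => ?_
        rw [enorm_mul]
        gcongr
        · rw [← ofReal_norm]
          exact ENNReal.ofReal_le_ofReal (hM x)
        · simp
    _ = ENNReal.ofReal K * eLpNorm (F • G) 1 μ := by
        rw [lintegral_const_mul' _ _ ENNReal.ofReal_ne_top, eLpNorm_one_eq_lintegral_enorm]
    _ ≤ _ := by
        gcongr
        exact eLpNorm_smul_le_mul_eLpNorm hG hF

variable {V : Type*} [NormedAddCommGroup V] [InnerProductSpace ℝ V] [FiniteDimensional ℝ V]
  [MeasurableSpace V] [BorelSpace V]

theorem fourierInv_mul_fourier {M φ : V → ℂ} (hM : Integrable M) (hφ : Integrable φ) (x : V) :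
    𝓕⁻ (fun ξ => M ξ * 𝓕 φ ξ) x = ∫ y, 𝓕⁻ M (x - y) * φ y := by
  have hE : Integrable fun ξ => Complex.exp ((2 * Real.pi * ⟪ξ, x⟫_ℝ : ℝ) * Complex.I) * M ξ := by
    refine hM.bdd_mul (c := 1) (by fun_prop) (Filter.Eventually.of_forall fun v => ?_)
    rw [Complex.norm_exp]; simp
  have h := integral_fourier_mul_eq_flip hE hφ
  have h1 : ∀ y, 𝓕 (fun ξ => Complex.exp ((2 * Real.pi * ⟪ξ, x⟫_ℝ : ℝ) * Complex.I) * M ξ) y =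
      𝓕⁻ M (x - y) := by
    intro y
    rw [Real.fourier_eq', Real.fourierInv_eq']
    congr 1
    ext v
    rw [smul_eq_mul, smul_eq_mul, ← mul_assoc, ← Complex.exp_add, inner_sub_right]
    congr 2
    push_cast; ring
  simp only [h1] at h
  rw [h, Real.fourierInv_eq']
  congr 1
  ext v
  rw [smul_eq_mul]
  ring

theorem norm_integral_mul_fourier_mul_fourierInv_le [Nontrivial V] {M φ g : V → ℂ} {K : ℝ}
    (hM : Integrable M) (hφ : Integrable φ) (hg : Integrable g) (hK : ∀ x ≠ 0, ‖𝓕⁻ M x‖ ≤ K) :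
    ‖∫ ξ, M ξ * (𝓕 φ ξ * 𝓕⁻ g ξ)‖ ≤ K * ((∫ x, ‖φ x‖) * ∫ x, ‖g x‖) := by
  have hMφ : Integrable fun ξ => M ξ * 𝓕 φ ξ :=
    hM.mul_bdd (c := ∫ x, ‖φ x‖) (continuous_fourier_of_integrable hφ).aestronglyMeasurable
      (Filter.Eventually.of_forall (norm_fourier_le_integral_norm φ))
  have h := integral_fourierInv_mul_eq_flip hMφ hg
  simp only [mul_assoc] at h
  rw [← h]
  have hb : ∀ x, ‖𝓕⁻ (fun ξ => M ξ * 𝓕 φ ξ) x‖ ≤ K * ∫ y, ‖φ y‖ := by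
    intro x
    rw [fourierInv_mul_fourier hM hφ, ← integral_const_mul]
    refine norm_integral_le_of_norm_le (hφ.norm.const_mul K) ?_
    have : ∀ᵐ y : V, y ≠ x := by
      simp [ae_iff, measure_singleton]
    filter_upwards [this] with y hy
    rw [norm_mul]
    gcongr
    exact hK _ (sub_ne_zero.2 hy.symm)
  calc _ ≤ ∫ x, (K * ∫ y, ‖φ y‖) * ‖g x‖ := by
        refine norm_integral_le_of_norm_le (hg.norm.const_mul _)
          (Filter.Eventually.of_forall fun x => ?_)
        rw [norm_mul]
        gcongr
        exact hb x
    _ = _ := by rw [integral_const_mul, mul_assoc]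

end BilinearForm

section Stretch

/-- The analytic family `c ↦ c |c| ^ (q (1 + z) / 2 - 1)`, which is the identity when
`q (1 + z) = 2` and satisfies `|c(z)| = |c| ^ (q (1 + Re z) / 2)`. -/
noncomputable def stretch (q : ℝ) (z c : ℂ) : ℂ := c * (‖c‖ : ℂ) ^ (q * (1 + z) / 2 - 1)

theorem stretch_zero (q : ℝ) (z : ℂ) : stretch q z 0 = 0 := by simp [stretch]

theorem norm_stretch {q : ℝ} (hq : 0 < q) {z : ℂ} (hz : 0 ≤ z.re) (c : ℂ) :
    ‖stretch q z c‖ = ‖c‖ ^ (q * (1 + z.re) / 2) := by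
  rcases eq_or_ne c 0 with rfl | hc
  · rw [stretch_zero, norm_zero, Real.zero_rpow (by positivity)]
  · have h0 : 0 < ‖c‖ := norm_pos_iff.2 hc
    rw [stretch, norm_mul, Complex.norm_cpow_eq_rpow_re_of_pos h0]
    have : (q * (1 + z) / 2 - 1 : ℂ).re = q * (1 + z.re) / 2 - 1 := by simp
    rw [this, Real.rpow_sub_one h0.ne']
    field_simp

theorem stretch_eq_self {q θ : ℝ} (h : q * (1 + θ) / 2 = 1) (c : ℂ) : stretch q θ c = c := by
  have : (q * (1 + θ) / 2 - 1 : ℂ) = 0 := by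
    rw [sub_eq_zero]; exact_mod_cast h
  rw [stretch, this, Complex.cpow_zero, mul_one]

theorem differentiable_stretch (q : ℝ) (c : ℂ) : Differentiable ℂ fun z => stretch q z c := by
  rcases eq_or_ne c 0 with rfl | hc
  · simp only [stretch_zero]; fun_prop
  · intro z
    refine DifferentiableAt.const_mul (DifferentiableAt.const_cpow (by fun_prop) (Or.inl ?_)) _
    simpa using hc

theorem norm_stretch_le {q : ℝ} (hq : 0 < q) {z : ℂ} (hz : 0 ≤ z.re) (hz1 : z.re ≤ 1) (c : ℂ) :
    ‖stretch q z c‖ ≤ (1 + ‖c‖) ^ q := by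
  rw [norm_stretch hq hz]
  have h := norm_nonneg c
  calc _ ≤ (1 + ‖c‖) ^ (q * (1 + z.re) / 2) := by gcongr; linarith
    _ ≤ _ := Real.rpow_le_rpow_of_exponent_le (by linarith) (by nlinarith)

end Stretch

section SimpleExpansion

variable {α : Type*} [MeasurableSpace α] {μ : Measure α}

/-- The nonzero values of a simple function. -/
noncomputable def nonzeroRange (φ : SimpleFunc α ℂ) : Finset ℂ := φ.range.filter (· ≠ 0)

/-- The indicator function of a fibre of a simple function. -/
noncomputable def fibreIndicator (φ : SimpleFunc α ℂ) (c : ℂ) : α → ℂ :=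
  (φ ⁻¹' {c}).indicator fun _ => 1

theorem comp_simpleFunc_eq_sum (φ : SimpleFunc α ℂ) {h : ℂ → ℂ} (h0 : h 0 = 0) :
    (fun x => h (φ x)) = fun x => ∑ c ∈ nonzeroRange φ, h c * fibreIndicator φ c x := by
  ext x
  rw [nonzeroRange, Finset.sum_filter_of_ne, Finset.sum_eq_single (φ x)]
  · simp [fibreIndicator]
  · intro c _ hc
    simp [fibreIndicator, Set.indicator, hc.symm]
  · intro hx
    exact absurd (SimpleFunc.mem_range_self φ x) hx
  · intro c _ hc hc0
    rw [hc0, h0, zero_mul] at hc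
    exact hc rfl

theorem integrable_fibreIndicator {φ : SimpleFunc α ℂ} (hφ : Integrable φ μ) {c : ℂ}
    (hc : c ∈ nonzeroRange φ) : Integrable (fibreIndicator φ c) μ := by
  rw [nonzeroRange, Finset.mem_filter] at hc
  refine (integrable_indicator_iff (φ.measurableSet_fiber c)).2 (integrableOn_const ?_)
  exact ((SimpleFunc.integrable_iff.1 hφ) c hc.2).ne

theorem integrable_comp_simpleFunc {φ : SimpleFunc α ℂ} (hφ : Integrable φ μ) {h : ℂ → ℂ}
    (h0 : h 0 = 0) : Integrable (fun x => h (φ x)) μ := by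
  rw [comp_simpleFunc_eq_sum φ h0]
  exact integrable_finsetSum _ fun c hc => (integrable_fibreIndicator hφ hc).const_mul _

theorem memLp_comp_simpleFunc {φ : SimpleFunc α ℂ} (hφ : Integrable φ μ) {h : ℂ → ℂ}
    (h0 : h 0 = 0) (p : ℝ≥0∞) : MemLp (fun x => h (φ x)) p μ := by
  have : Integrable (φ.map h) μ := integrable_comp_simpleFunc hφ h0
  exact SimpleFunc.memLp_of_finite_measure_preimage p (SimpleFunc.integrable_iff.1 this)

variable {V : Type*} [NormedAddCommGroup V] [InnerProductSpace ℝ V] [FiniteDimensional ℝ V]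
  [MeasurableSpace V] [BorelSpace V]

theorem fourier_finsetSum_mul {ι : Type*} (s : Finset ι) (a : ι → ℂ) (f : ι → V → ℂ)
    (hf : ∀ i ∈ s, Integrable (f i)) (ξ : V) :
    𝓕 (fun x => ∑ i ∈ s, a i * f i x) ξ = ∑ i ∈ s, a i * 𝓕 (f i) ξ := by
  simp only [Real.fourier_eq', smul_eq_mul, Finset.mul_sum]
  rw [integral_finsetSum]
  · refine Finset.sum_congr rfl fun i _ => ?_
    rw [← integral_const_mul]
    congr 1; ext v; ring
  · intro i hi
    refine ((hf i hi).const_mul (a i)).bdd_mul (c := 1) (by fun_prop)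
      (Filter.Eventually.of_forall fun v => ?_)
    rw [Complex.norm_exp]; simp

theorem fourier_comp_simpleFunc {φ : SimpleFunc V ℂ} (hφ : Integrable φ) {h : ℂ → ℂ}
    (h0 : h 0 = 0) (ξ : V) :
    𝓕 (fun x => h (φ x)) ξ = ∑ c ∈ nonzeroRange φ, h c * 𝓕 (fibreIndicator φ c) ξ := by
  rw [comp_simpleFunc_eq_sum φ h0]
  exact fourier_finsetSum_mul _ _ _ (fun c hc => integrable_fibreIndicator hφ hc) ξ

theorem fourierInv_comp_simpleFunc {φ : SimpleFunc V ℂ} (hφ : Integrable φ) {h : ℂ → ℂ}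
    (h0 : h 0 = 0) (ξ : V) :
    𝓕⁻ (fun x => h (φ x)) ξ = ∑ c ∈ nonzeroRange φ, h c * 𝓕⁻ (fibreIndicator φ c) ξ := by
  simp only [Real.fourierInv_eq_fourier_neg]
  exact fourier_comp_simpleFunc hφ h0 _

end SimpleExpansion

section Interpolation

open Complex.HadamardThreeLines

theorem DiffContOnCl.finsetSum {ι : Type*} {s : Set ℂ} (t : Finset ι) {F : ι → ℂ → ℂ}
    (h : ∀ i ∈ t, DiffContOnCl ℂ (F i) s) : DiffContOnCl ℂ (fun z => ∑ i ∈ t, F i z) s :=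
  ⟨DifferentiableOn.fun_sum fun i hi => (h i hi).1, continuousOn_finsetSum _ fun i hi => (h i hi).2⟩

theorem norm_exp_sq (z : ℂ) : ‖Complex.exp (z ^ 2)‖ = Real.exp (z.re ^ 2 - z.im ^ 2) := by
  rw [Complex.norm_exp]
  congr 1
  simp [sq]

theorem exp_neg_sq_mul_one_add_abs_le (y : ℝ) : Real.exp (-y ^ 2) * (1 + |y|) ≤ 2 := by
  have h1 : 1 + y ^ 2 ≤ Real.exp (y ^ 2) := by linarith [Real.add_one_le_exp (y ^ 2)]
  have h2 : 1 + |y| ≤ 2 * (1 + y ^ 2) := by nlinarith [sq_abs y, sq_nonneg (|y| - 1 / 2)]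
  rw [Real.exp_neg, inv_mul_le_iff₀ (Real.exp_pos _)]
  linarith

theorem exp_one_sub_sq_mul_le (y : ℝ) :
    Real.exp (1 - y ^ 2) * (8 * ((4 * |y| + 2) * Real.exp (Real.pi * |y|))) ≤
      32 * Real.exp 8 := by
  have h1 : 4 * |y| + 2 ≤ 4 * Real.exp |y| := by linarith [Real.add_one_le_exp |y|]
  calc _ ≤ Real.exp (1 - y ^ 2) * (8 * ((4 * Real.exp |y|) * Real.exp (Real.pi * |y|))) := by
        gcongr
    _ = 32 * Real.exp (1 - y ^ 2 + |y| + Real.pi * |y|) := by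
        rw [Real.exp_add, Real.exp_add]; ring
    _ ≤ _ := by
        gcongr
        have := Real.pi_lt_d2
        nlinarith [sq_abs y, abs_nonneg y, sq_nonneg (|y| - 5 / 2)]

theorem norm_exp_sq_mul_one_sub_le {z : ℂ} (h0 : 0 ≤ z.re) (h1 : z.re ≤ 1) :
    ‖Complex.exp (z ^ 2) * (1 - z)‖ ≤ Real.exp (z.re ^ 2) * 2 := by
  rw [norm_mul, norm_exp_sq, sub_eq_add_neg, Real.exp_add, mul_assoc]
  gcongr
  refine le_trans ?_ (exp_neg_sq_mul_one_add_abs_le z.im)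
  gcongr
  refine (Complex.norm_le_abs_re_add_abs_im _).trans ?_
  simp only [Complex.sub_re, Complex.one_re, Complex.sub_im, Complex.one_im, zero_sub, abs_neg]
  gcongr
  rw [abs_le]; constructor <;> linarith

/-- The bilinear form of the damped multiplier, evaluated along the analytic families through two
simple functions. -/
noncomputable def stretchedForm (t ε δ q : ℝ) (φ g : SimpleFunc (EuclideanSpace ℝ (Fin 3)) ℂ)
    (z : ℂ) : ℂ :=
  ∫ ξ : EuclideanSpace ℝ (Fin 3), dampedSymbol t ε δ z ‖ξ‖ *
    (𝓕 (fun x => stretch q z (φ x)) ξ * 𝓕⁻ (fun x => stretch q z (g x)) ξ)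

variable {t ε δ q : ℝ} {φ g : SimpleFunc (EuclideanSpace ℝ (Fin 3)) ℂ}

theorem norm_fourier_mul_fourierInv_le {V : Type*} [NormedAddCommGroup V] [InnerProductSpace ℝ V]
    [FiniteDimensional ℝ V] [MeasurableSpace V] [BorelSpace V] (u v : V → ℂ) (ξ : V) :
    ‖𝓕 u ξ * 𝓕⁻ v ξ‖ ≤ (∫ x, ‖u x‖) * ∫ x, ‖v x‖ := by
  rw [norm_mul]
  gcongr
  · exact norm_fourier_le_integral_norm _ _
  · exact norm_fourierInv_le_integral_norm _ _

theorem stretchedForm_eq_sum (hε : 0 < ε) (hδ : 0 < δ) (hφ : Integrable φ) (hg : Integrable g)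
    {z : ℂ} (hz0 : 0 ≤ z.re) (hz1 : z.re ≤ 1) :
    stretchedForm t ε δ q φ g z = ∑ c ∈ nonzeroRange φ, ∑ d ∈ nonzeroRange g,
      stretch q z c * stretch q z d * ∫ ξ, dampedSymbol t ε δ z ‖ξ‖ *
        (𝓕 (fibreIndicator φ c) ξ * 𝓕⁻ (fibreIndicator g d) ξ) := by
  have hInt : ∀ c ∈ nonzeroRange φ, ∀ d ∈ nonzeroRange g,
      Integrable fun ξ => dampedSymbol t ε δ z ‖ξ‖ *
        (𝓕 (fibreIndicator φ c) ξ * 𝓕⁻ (fibreIndicator g d) ξ) := fun c hc d hd =>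
    integrable_dampedSymbol_mul hε hδ
      ((continuous_fourier_of_integrable (integrable_fibreIndicator hφ hc)).mul
        (continuous_fourierInv_of_integrable (integrable_fibreIndicator hg hd))).aestronglyMeasurable
      (norm_fourier_mul_fourierInv_le _ _) hz0 hz1
  simp only [stretchedForm, fourier_comp_simpleFunc hφ (stretch_zero q z),
    fourierInv_comp_simpleFunc hg (stretch_zero q z), Finset.sum_mul_sum]
  simp only [Finset.mul_sum]
  rw [integral_finsetSum]
  · refine Finset.sum_congr rfl fun c hc => ?_
    rw [integral_finsetSum]
    · refine Finset.sum_congr rfl fun d hd => ?_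
      rw [← integral_const_mul]
      congr 1; ext ξ; ring
    · intro d hd
      exact ((hInt c hc d hd).const_mul (stretch q z c * stretch q z d)).congr
        (Filter.Eventually.of_forall fun ξ => by ring)
  · intro c hc
    refine integrable_finsetSum _ fun d hd => ?_
    exact ((hInt c hc d hd).const_mul (stretch q z c * stretch q z d)).congr
        (Filter.Eventually.of_forall fun ξ => by ring)

theorem diffContOnCl_stretchedForm (hε : 0 < ε) (hδ : 0 < δ) (hφ : Integrable φ)
    (hg : Integrable g) : DiffContOnCl ℂ (stretchedForm t ε δ q φ g) (verticalStrip 0 1) := by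
  have hcl : closure (verticalStrip 0 1) ⊆ Complex.re ⁻¹' Set.Icc 0 1 :=
    closure_minimal (Set.preimage_mono Set.Ioo_subset_Icc_self)
      (isClosed_Icc.preimage Complex.continuous_re)
  have h : DiffContOnCl ℂ (fun z => ∑ c ∈ nonzeroRange φ, ∑ d ∈ nonzeroRange g,
      stretch q z c * stretch q z d * ∫ ξ, dampedSymbol t ε δ z ‖ξ‖ *
        (𝓕 (fibreIndicator φ c) ξ * 𝓕⁻ (fibreIndicator g d) ξ)) (verticalStrip 0 1) := by
    refine DiffContOnCl.finsetSum _ fun c hc => DiffContOnCl.finsetSum _ fun d hd => ?_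
    refine DiffContOnCl.smul (Differentiable.diffContOnCl
      ((differentiable_stretch q c).mul (differentiable_stretch q d)))
      (diffContOnCl_integral_dampedSymbol_mul hε hδ ?_ (norm_fourier_mul_fourierInv_le _ _))
    exact ((continuous_fourier_of_integrable (integrable_fibreIndicator hφ hc)).mul
      (continuous_fourierInv_of_integrable (integrable_fibreIndicator hg hd))).aestronglyMeasurable
  have heq : Set.EqOn (stretchedForm t ε δ q φ g) _ (closure (verticalStrip 0 1)) := fun z hz =>
    stretchedForm_eq_sum (t := t) (q := q) hε hδ hφ hg (hcl hz).1 (hcl hz).2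
  exact ⟨h.1.congr fun z hz => heq (subset_closure hz), h.2.congr heq⟩

theorem exists_norm_stretchedForm_le (hε : 0 < ε) (hδ : 0 < δ) (hq : 0 < q) (hφ : Integrable φ)
    (hg : Integrable g) : ∃ B, ∀ z : ℂ, 0 ≤ z.re → z.re ≤ 1 →
      ‖stretchedForm t ε δ q φ g z‖ ≤ B := by
  refine ⟨∑ c ∈ nonzeroRange φ, ∑ d ∈ nonzeroRange g, (1 + ‖c‖) ^ q * (1 + ‖d‖) ^ q *
    ∫ ξ : EuclideanSpace ℝ (Fin 3), (1 + δ ^ 2) * ((∫ x, ‖fibreIndicator φ c x‖) *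
      ∫ x, ‖fibreIndicator g d x‖) * Real.exp (-(ε * ‖ξ‖)), fun z hz0 hz1 => ?_⟩
  rw [stretchedForm_eq_sum hε hδ hφ hg hz0 hz1]
  refine norm_sum_le_of_le _ fun c hc => norm_sum_le_of_le _ fun d hd => ?_
  rw [norm_mul, norm_mul]
  gcongr
  · exact norm_stretch_le hq hz0 hz1 c
  · exact norm_stretch_le hq hz0 hz1 d
  · exact norm_integral_dampedSymbol_mul_le hε hδ (norm_fourier_mul_fourierInv_le _ _) hz0 hz1

theorem eLpNorm_two_stretch (hq : 0 < q) (hφ : Integrable φ) {z : ℂ} (hz : z.re = 0) :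
    eLpNorm (fun x => stretch q z (φ x)) 2 = ENNReal.ofReal ((∫ x, ‖φ x‖ ^ q) ^ (1 / 2 : ℝ)) := by
  rw [(memLp_comp_simpleFunc hφ (stretch_zero q z) 2).eLpNorm_eq_integral_rpow_norm (by simp)
    (by simp)]
  simp only [norm_stretch hq hz.ge, ENNReal.toReal_ofNat, hz, add_zero, mul_one, one_div]
  congr 3
  ext x
  rw [← Real.rpow_mul (norm_nonneg _)]
  congr 1; ring

theorem norm_stretchedForm_le_of_re_eq_zero (hε : 0 < ε) (hδ : 0 < δ) (hq : 0 < q)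
    (hφ : Integrable φ) (hg : Integrable g) {z : ℂ} (hz : z.re = 0) :
    ‖stretchedForm t ε δ q φ g z‖ ≤
      ((∫ x, ‖φ x‖ ^ q) * ∫ x, ‖g x‖ ^ q) ^ (1 / 2 : ℝ) := by
  have h1 := integrable_comp_simpleFunc hφ (stretch_zero q z)
  have h2 := integrable_comp_simpleFunc hg (stretch_zero q z)
  have h := enorm_integral_mul_mul_le (μ := volume) (K := 1)
    (fun ξ : EuclideanSpace ℝ (Fin 3) =>
      norm_dampedSymbol_le_one (t := t) hε hδ hz (norm_nonneg ξ))
    (continuous_fourier_of_integrable h1).aestronglyMeasurable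
    (continuous_fourierInv_of_integrable h2).aestronglyMeasurable
  rw [eLpNorm_two_fourier h1 (memLp_comp_simpleFunc hφ (stretch_zero q z) 2),
    eLpNorm_two_fourierInv h2 (memLp_comp_simpleFunc hg (stretch_zero q z) 2),
    eLpNorm_two_stretch hq hφ hz, eLpNorm_two_stretch hq hg hz, ENNReal.ofReal_one, one_mul,
    ← ENNReal.ofReal_mul (by positivity), ← Real.mul_rpow (by positivity) (by positivity),
    ← ofReal_norm] at h
  exact (ENNReal.ofReal_le_ofReal_iff (by positivity)).1 h

theorem norm_stretchedForm_le_of_re_eq_one (ht : 0 < t) (hε : 0 < ε) (hδ : 0 < δ) (hq : 0 < q)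
    (hφ : Integrable φ) (hg : Integrable g) {z : ℂ} (hz : z.re = 1) :
    ‖Complex.exp (z ^ 2) * (1 - z) * stretchedForm t ε δ q φ g z‖ ≤
      32 * Real.exp 8 / t * ((∫ x, ‖φ x‖ ^ q) * ∫ x, ‖g x‖ ^ q) := by
  have hzeq : z = 1 + z.im * Complex.I := by
    apply Complex.ext <;> simp [hz]
  set γ := z.im with hγ
  have h1z : ‖1 - z‖ = |γ| := by rw [hzeq]; simp
  rw [norm_mul, norm_mul, norm_exp_sq, h1z, ← hγ, hz]
  rcases eq_or_ne γ 0 with h0 | h0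
  · rw [h0]; simp; positivity
  have hγ0 : 0 < |γ| := abs_pos.2 h0
  have h := norm_integral_mul_fourier_mul_fourierInv_le
    (integrable_dampedSymbol_one_add t γ hε hδ)
    (integrable_comp_simpleFunc hφ (stretch_zero q z))
    (integrable_comp_simpleFunc hg (stretch_zero q z))
    (K := 8 * ((4 * |γ| + 2) * Real.exp (Real.pi * |γ|) / t) / |γ|)
    (fun x hx => by
      rw [le_div_iff₀' hγ0]; exact norm_fourierInv_dampedSymbol_le ht hε hδ γ hx)
  rw [← hzeq] at h
  have hst : ∀ c, ‖stretch q z c‖ = ‖c‖ ^ q := by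
    intro c
    rw [norm_stretch hq (by rw [hz]; exact zero_le_one), hz]
    congr 1; ring
  simp only [hst] at h
  change ‖stretchedForm t ε δ q φ g z‖ ≤ _ at h
  calc _ ≤ Real.exp (1 ^ 2 - γ ^ 2) * |γ| *
        (8 * ((4 * |γ| + 2) * Real.exp (Real.pi * |γ|) / t) / |γ| *
          ((∫ x, ‖φ x‖ ^ q) * ∫ x, ‖g x‖ ^ q)) := by gcongr
    _ = Real.exp (1 - γ ^ 2) * (8 * ((4 * |γ| + 2) * Real.exp (Real.pi * |γ|))) / t *
        ((∫ x, ‖φ x‖ ^ q) * ∫ x, ‖g x‖ ^ q) := by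
        rw [one_pow]; field_simp
    _ ≤ _ := by gcongr ?_ / t * _; exact exp_one_sub_sq_mul_le γ

theorem enorm_integral_dampedSymbol_mul_simpleFunc_le (ht : 0 < t) (hε : 0 < ε) (hδ : 0 < δ)
    {θ : ℝ} (hθ0 : 0 ≤ θ) (hθ1 : θ < 1) (hq : 0 < q) (hqθ : q * (1 + θ) / 2 = 1)
    (hφ : Integrable φ) (hg : Integrable g) :
    ‖∫ ξ : EuclideanSpace ℝ (Fin 3), dampedSymbol t ε δ θ ‖ξ‖ * (𝓕 (⇑φ) ξ * 𝓕⁻ (⇑g) ξ)‖ₑ ≤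
      ENNReal.ofReal (64 * Real.exp 8 / (1 - θ) * t ^ (-θ)) *
        (eLpNorm φ (ENNReal.ofReal q) * eLpNorm g (ENNReal.ofReal q)) := by
  have hq0 : ENNReal.ofReal q ≠ 0 := (ENNReal.ofReal_pos.2 hq).ne'
  have hφq : MemLp φ (ENNReal.ofReal q) := memLp_comp_simpleFunc hφ (h := id) rfl _
  have hgq : MemLp g (ENNReal.ofReal q) := memLp_comp_simpleFunc hg (h := id) rfl _
  rw [hφq.eLpNorm_eq_integral_rpow_norm hq0 (by simp), hgq.eLpNorm_eq_integral_rpow_norm hq0 (by simp),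
    ENNReal.toReal_ofReal hq.le, ← ENNReal.ofReal_mul (by positivity),
    ← Real.mul_rpow (by positivity) (by positivity),
    ← ENNReal.ofReal_mul (mul_nonneg (div_nonneg (by positivity) (by linarith)) (by positivity)),
    ← ofReal_norm]
  refine ENNReal.ofReal_le_ofReal ?_
  set A := (∫ x, ‖φ x‖ ^ q) * ∫ x, ‖g x‖ ^ q with hA
  have hA0 : 0 ≤ A := by positivity
  obtain ⟨B, hB⟩ := exists_norm_stretchedForm_le (t := t) hε hδ hq hφ hg
  have hself : stretchedForm t ε δ q φ g θ =
      ∫ ξ : EuclideanSpace ℝ (Fin 3), dampedSymbol t ε δ θ ‖ξ‖ * (𝓕 (⇑φ) ξ * 𝓕⁻ (⇑g) ξ) := by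
    simp only [stretchedForm, stretch_eq_self hqθ]
  have key := norm_le_interp_of_mem_verticalClosedStrip₀₁'
    (fun z => Complex.exp (z ^ 2) * (1 - z) * stretchedForm t ε δ q φ g z) (z := θ)
    (a := 2 * A ^ (1 / 2 : ℝ)) (b := 32 * Real.exp 8 / t * A)
    (by simp [verticalClosedStrip, hθ0, hθ1.le])
    (DiffContOnCl.smul (Differentiable.diffContOnCl (f := fun z => Complex.exp (z ^ 2) * (1 - z))
      (by fun_prop)) (diffContOnCl_stretchedForm hε hδ hφ hg))
    ?_ ?_ ?_
  · rw [norm_mul, norm_mul, norm_exp_sq, hself] at key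
    simp only [Complex.ofReal_re, Complex.ofReal_im] at key
    have h1 : ‖(1 - θ : ℂ)‖ = 1 - θ := by
      rw [← Complex.ofReal_one, ← Complex.ofReal_sub, Complex.norm_real, Real.norm_of_nonneg]
      linarith
    have hexp : 1 ≤ Real.exp (θ ^ 2 - 0 ^ 2) := Real.one_le_exp (by nlinarith)
    have hqinv : q⁻¹ = 1 / 2 * (1 - θ) + θ := by
      rw [inv_eq_of_mul_eq_one_right (b := (1 + θ) / 2) (by linarith)]; ring
    have hrhs : (2 * A ^ (1 / 2 : ℝ)) ^ (1 - θ) * (32 * Real.exp 8 / t * A) ^ θ =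
        2 ^ (1 - θ) * (32 * Real.exp 8) ^ θ * t ^ (-θ) * A ^ q⁻¹ := by
      rw [Real.mul_rpow (by positivity) (by positivity), Real.mul_rpow (by positivity) hA0,
        Real.div_rpow (by positivity) ht.le, ← Real.rpow_mul hA0, hqinv,
        Real.rpow_add_of_nonneg hA0 (by linarith) hθ0, Real.rpow_neg ht.le]
      ring
    have h2 : (2 : ℝ) ^ (1 - θ) ≤ 2 ^ (1 : ℝ) :=
      Real.rpow_le_rpow_of_exponent_le one_le_two (by linarith)
    have h3 : (32 * Real.exp 8) ^ θ ≤ (32 * Real.exp 8) ^ (1 : ℝ) :=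
      Real.rpow_le_rpow_of_exponent_le (by linarith [Real.one_le_exp (x := 8) (by norm_num)])
        hθ1.le
    rw [Real.rpow_one] at h2 h3
    rw [h1, hrhs] at key
    have hθ : 0 < 1 - θ := by linarith
    rw [div_mul_eq_mul_div, div_mul_eq_mul_div, le_div_iff₀' hθ]
    calc _ ≤ Real.exp (θ ^ 2 - 0 ^ 2) * (1 - θ) * _ := by
          gcongr ?_ * _
          exact le_mul_of_one_le_left hθ.le hexp
      _ ≤ _ := key
      _ ≤ 2 * (32 * Real.exp 8) * t ^ (-θ) * A ^ q⁻¹ := by gcongr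
      _ = _ := by ring
  · refine ⟨Real.exp 1 * 2 * B, ?_⟩
    rintro _ ⟨z, ⟨hz0, hz1⟩, rfl⟩
    simp only [Function.comp_apply]
    rw [norm_mul]
    gcongr
    · refine (norm_exp_sq_mul_one_sub_le hz0 hz1).trans ?_
      gcongr
      exact pow_le_one₀ hz0 hz1
    · exact hB z hz0 hz1
  · intro z hz
    have hz' : z.re = 0 := hz
    rw [norm_mul]
    gcongr
    · simpa [hz'] using norm_exp_sq_mul_one_sub_le hz'.ge (hz'.trans_le zero_le_one)
    · exact norm_stretchedForm_le_of_re_eq_zero hε hδ hq hφ hg hz'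
  · intro z hz
    exact norm_stretchedForm_le_of_re_eq_one ht hε hδ hq hφ hg hz

end Interpolation

section Approximation

open Filter Topology

theorem tendsto_integral_mul_mul_of_tendsto_eLpNorm {α : Type*} [MeasurableSpace α] {μ : Measure α}
    {M F G : α → ℂ} {Fn : ℕ → α → ℂ} {K : ℝ} (hMm : AEStronglyMeasurable M μ)
    (hM : ∀ x, ‖M x‖ ≤ K) (hF : MemLp F 2 μ) (hFn : ∀ n, MemLp (Fn n) 2 μ) (hG : MemLp G 2 μ)
    (h : Tendsto (fun n => eLpNorm (Fn n - F) 2 μ) atTop (𝓝 0)) :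
    Tendsto (fun n => ∫ x, M x * (Fn n x * G x) ∂μ) atTop (𝓝 (∫ x, M x * (F x * G x) ∂μ)) := by
  have hInt : ∀ {F : α → ℂ}, MemLp F 2 μ → Integrable (fun x => M x * (F x * G x)) μ :=
    fun {F} hF => (hF.integrable_mul hG).bdd_mul hMm (Eventually.of_forall hM)
  rw [tendsto_iff_edist_tendsto_0]
  refine tendsto_of_tendsto_of_tendsto_of_le_of_le tendsto_const_nhds
    (h := fun n => ENNReal.ofReal K * (eLpNorm (Fn n - F) 2 μ * eLpNorm G 2 μ)) ?_
    (fun _ => zero_le) fun n => ?_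
  · have h1 := ENNReal.Tendsto.const_mul (a := ENNReal.ofReal K)
      (ENNReal.Tendsto.mul_const (b := eLpNorm G 2 μ) h (Or.inr hG.2.ne))
      (Or.inr ENNReal.ofReal_ne_top)
    simpa using h1
  · simp only [edist_eq_enorm_sub]
    rw [← integral_sub (hInt (hFn n)) (hInt hF)]
    have hsub : ∀ x, M x * (Fn n x * G x) - M x * (F x * G x) = M x * ((Fn n - F) x * G x) :=
      fun x => by rw [Pi.sub_apply]; ring
    simp only [hsub]
    exact enorm_integral_mul_mul_le hM ((hFn n).sub hF).1 hG.1

theorem exists_simpleFunc_tendsto_eLpNorm {α : Type*} [MeasurableSpace α] {μ : Measure α}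
    {f : α → ℂ} {q : ℝ≥0∞} (hq1 : 1 ≤ q) (hq : q ≠ ∞) (hf : Measurable f) (h2 : MemLp f 2 μ)
    (hfq : MemLp f q μ) : ∃ φ : ℕ → SimpleFunc α ℂ, (∀ n, MemLp (φ n) 2 μ) ∧
      (∀ n, Integrable (φ n) μ) ∧ Tendsto (fun n => eLpNorm (⇑(φ n) - f) 2 μ) atTop (𝓝 0) ∧
      Tendsto (fun n => eLpNorm (φ n) q μ) atTop (𝓝 (eLpNorm f q μ)) := by
  have : Fact (1 ≤ q) := ⟨hq1⟩
  have m2 := SimpleFunc.memLp_approxOn_range hf h2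
  refine ⟨fun n => SimpleFunc.approxOn f hf (Set.range f ∪ {0}) 0 (by simp) n, m2,
    fun n => (SimpleFunc.memLp_iff_integrable two_ne_zero ENNReal.ofNat_ne_top).1 (m2 n),
    SimpleFunc.tendsto_approxOn_range_Lp_eLpNorm ENNReal.ofNat_ne_top hf h2.2, ?_⟩
  simpa only [Lp.enorm_toLp] using (SimpleFunc.tendsto_approxOn_range_Lp hq hf hfq).enorm

theorem fourierInv_sub_of_integrable {V : Type*} [NormedAddCommGroup V] [InnerProductSpace ℝ V]
    [FiniteDimensional ℝ V] [MeasurableSpace V] [BorelSpace V] {f g : V → ℂ} (hf : Integrable f)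
    (hg : Integrable g) : 𝓕⁻ (f - g) = 𝓕⁻ f - 𝓕⁻ g := by
  have hE : ∀ {f : V → ℂ}, Integrable f → ∀ x, Integrable fun ξ =>
      Complex.exp ((2 * Real.pi * ⟪ξ, x⟫_ℝ : ℝ) * Complex.I) * f ξ := fun {f} hf x => by
    refine hf.bdd_mul (c := 1) (by fun_prop) (Eventually.of_forall fun v => ?_)
    rw [Complex.norm_exp]; simp
  ext x
  simp only [Pi.sub_apply, Real.fourierInv_eq', smul_eq_mul, mul_sub]
  exact integral_sub (hE hf x) (hE hg x)

theorem enorm_integral_dampedSymbol_mul_le {t ε δ θ q : ℝ} (ht : 0 < t) (hε : 0 < ε) (hδ : 0 < δ)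
    (hθ0 : 0 ≤ θ) (hθ1 : θ < 1) (hqθ : q * (1 + θ) / 2 = 1)
    {H g : EuclideanSpace ℝ (Fin 3) → ℂ} (H1 : Integrable H) (H2 : MemLp H 2)
    (Hq : MemLp (𝓕⁻ H) (ENNReal.ofReal q)) (hg : Measurable g) (g1 : Integrable g)
    (g2 : MemLp g 2) (gq : MemLp g (ENNReal.ofReal q)) :
    ‖∫ ξ : EuclideanSpace ℝ (Fin 3), dampedSymbol t ε δ θ ‖ξ‖ * (H ξ * 𝓕⁻ g ξ)‖ₑ ≤
      ENNReal.ofReal (64 * Real.exp 8 / (1 - θ) * t ^ (-θ)) *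
        (eLpNorm (𝓕⁻ H) (ENNReal.ofReal q) * eLpNorm g (ENNReal.ofReal q)) := by
  have hq1 : 1 ≤ q := by nlinarith
  have hq1' : 1 ≤ ENNReal.ofReal q := by simpa using hq1
  have hMm := (measurable_dampedSymbol_norm t ε δ θ).aestronglyMeasurable (μ := volume)
  have hM : ∀ ξ : EuclideanSpace ℝ (Fin 3), ‖dampedSymbol t ε δ θ ‖ξ‖‖ ≤ 1 + δ ^ 2 := fun ξ => by
    refine (norm_dampedSymbol_le hδ (by simpa) (by simpa using hθ1.le) (norm_nonneg ξ)).trans ?_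
    refine mul_le_of_le_one_right (by positivity) (Real.exp_le_one_iff.2 ?_)
    have := norm_nonneg ξ
    simp only [neg_nonpos]; positivity
  obtain ⟨φ, φ2, φ1, hφ2, hφq⟩ := exists_simpleFunc_tendsto_eLpNorm hq1' ENNReal.ofReal_ne_top
    (continuous_fourierInv_of_integrable H1).measurable (memLp_two_fourierInv H1 H2) Hq
  obtain ⟨γ, γ2, γ1, hγ2, hγq⟩ := exists_simpleFunc_tendsto_eLpNorm hq1' ENNReal.ofReal_ne_top
    hg g2 gq
  have hsimple : ∀ m, ‖∫ ξ : EuclideanSpace ℝ (Fin 3), dampedSymbol t ε δ θ ‖ξ‖ *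
      (H ξ * 𝓕⁻ (⇑(γ m)) ξ)‖ₑ ≤ ENNReal.ofReal (64 * Real.exp 8 / (1 - θ) * t ^ (-θ)) *
        (eLpNorm (𝓕⁻ H) (ENNReal.ofReal q) * eLpNorm (γ m) (ENNReal.ofReal q)) := by
    intro m
    have hlim := tendsto_integral_mul_mul_of_tendsto_eLpNorm hMm hM H2
      (fun n => memLp_two_fourier (φ1 n) (φ2 n)) (memLp_two_fourierInv (γ1 m) (γ2 m))
      (by simpa only [eLpNorm_fourier_sub (φ1 _) (φ2 _) H1 H2] using hφ2)
    have hγm : eLpNorm (γ m) (ENNReal.ofReal q) volume ≠ ∞ :=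
      (memLp_comp_simpleFunc (γ1 m) (h := id) rfl _).2.ne
    refine le_of_tendsto_of_tendsto' hlim.enorm (ENNReal.Tendsto.const_mul
      (ENNReal.Tendsto.mul_const hφq (Or.inr hγm)) (Or.inr ENNReal.ofReal_ne_top)) fun n => ?_
    exact enorm_integral_dampedSymbol_mul_simpleFunc_le ht hε hδ hθ0 hθ1 (by linarith) hqθ
      (φ1 n) (γ1 m)
  have hlim := tendsto_integral_mul_mul_of_tendsto_eLpNorm hMm hM (memLp_two_fourierInv g1 g2)
    (fun n => memLp_two_fourierInv (γ1 n) (γ2 n)) H2 (by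
      simpa only [← fourierInv_sub_of_integrable (γ1 _) g1,
        eLpNorm_two_fourierInv ((γ1 _).sub g1) ((γ2 _).sub g2)] using hγ2)
  simp only [fun ξ (u : ℂ) => mul_comm u (H ξ)] at hlim
  exact le_of_tendsto_of_tendsto' hlim.enorm (ENNReal.Tendsto.const_mul
    (ENNReal.Tendsto.const_mul hγq (Or.inr Hq.2.ne)) (Or.inr ENNReal.ofReal_ne_top)) hsimple

end Approximation

section Duality

variable {α : Type*}

/-- The extremal test function on `S` for the `L^p` norm of `u`. -/
noncomputable def extremalTest (p : ℝ) (u : α → ℂ) (S : Set α) : α → ℂ :=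
  S.indicator fun x => (‖u x‖ ^ (p - 2) : ℝ) * (starRingEnd ℂ) (u x)

theorem norm_extremalTest {p : ℝ} (hp : 2 ≤ p) (u : α → ℂ) (S : Set α) (x : α) :
    ‖extremalTest p u S x‖ = S.indicator (fun x => ‖u x‖ ^ (p - 1)) x := by
  by_cases hx : x ∈ S
  · rw [extremalTest, Set.indicator_of_mem hx, Set.indicator_of_mem hx, norm_mul,
      Complex.norm_real, Real.norm_of_nonneg (by positivity), RCLike.norm_conj]
    rw [show p - 1 = p - 2 + 1 by ring, Real.rpow_add_of_nonneg (norm_nonneg _) (by linarith)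
      zero_le_one, Real.rpow_one]
  · simp [extremalTest, hx]

theorem mul_extremalTest {p : ℝ} (hp : 2 ≤ p) (u : α → ℂ) (S : Set α) (x : α) :
    u x * extremalTest p u S x = (S.indicator (fun x => ‖u x‖ ^ p) x : ℝ) := by
  by_cases hx : x ∈ S
  · rw [extremalTest, Set.indicator_of_mem hx, Set.indicator_of_mem hx, mul_left_comm,
      Complex.mul_conj, ← Complex.ofReal_mul, Complex.normSq_eq_norm_sq]
    rw [← Real.rpow_two, ← Real.rpow_add_of_nonneg (norm_nonneg _) (by linarith) zero_le_two]
    ring_nf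
  · simp [extremalTest, hx]

variable [MeasurableSpace α] {μ : Measure α}

theorem eLpNorm_restrict_le_of_forall_enorm_integral_mul_le {u : α → ℂ} (hu : Measurable u) {b : ℝ}
    (hb : ∀ x, ‖u x‖ ≤ b) {p q : ℝ} (hp : 2 ≤ p) (hpq : p.HolderConjugate q) {K : ℝ≥0∞}
    (h : ∀ g : α → ℂ, Measurable g → (∀ r : ℝ≥0∞, MemLp g r μ) →
      ‖∫ x, u x * g x ∂μ‖ₑ ≤ K * eLpNorm g (ENNReal.ofReal q) μ) {S : Set α}
    (hS : MeasurableSet S) (hμS : μ S ≠ ∞) :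
    eLpNorm u (ENNReal.ofReal p) (μ.restrict S) ≤ K := by
  have hp0 : 0 < p := by linarith
  have hfin : IsFiniteMeasure (μ.restrict S) := ⟨by simpa using hμS.lt_top⟩
  set g := extremalTest p u S with hg
  have hgm : Measurable g := by
    refine Measurable.indicator ?_ hS
    exact (Complex.measurable_ofReal.comp (hu.norm.pow_const _)).mul
      (Complex.continuous_conj.measurable.comp hu)
  have hgr : ∀ r : ℝ≥0∞, MemLp g r μ := by
    intro r
    rw [hg, extremalTest, memLp_indicator_iff_restrict hS]
    refine MemLp.of_bound (C := b ^ (p - 1)) ?_ (Filter.Eventually.of_forall fun x => ?_)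
    · exact ((Complex.measurable_ofReal.comp (hu.norm.pow_const _)).mul
        (Complex.continuous_conj.measurable.comp hu)).aestronglyMeasurable
    · have := norm_extremalTest hp u Set.univ x
      simp only [extremalTest, Set.indicator_univ] at this
      rw [this]
      exact Real.rpow_le_rpow (norm_nonneg _) (hb x) (by linarith)
  have huS : MemLp u (ENNReal.ofReal p) (μ.restrict S) :=
    MemLp.of_bound hu.aestronglyMeasurable b (Filter.Eventually.of_forall hb)
  set J := ∫ x in S, ‖u x‖ ^ p ∂μ with hJ
  have hJ0 : 0 ≤ J := integral_nonneg fun x => by positivity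
  have hleft : ∫ x, u x * g x ∂μ = (J : ℂ) := by
    simp only [hg, mul_extremalTest hp]
    rw [integral_complex_ofReal, integral_indicator hS]
  have hright : eLpNorm g (ENNReal.ofReal q) μ = ENNReal.ofReal (J ^ q⁻¹) := by
    rw [(hgr _).eLpNorm_eq_integral_rpow_norm (ENNReal.ofReal_pos.2 hpq.symm.pos).ne' (by simp),
      ENNReal.toReal_ofReal hpq.symm.nonneg, hJ, ← integral_indicator hS]
    congr 3
    ext x
    rw [hg, norm_extremalTest hp]
    by_cases hx : x ∈ S
    · rw [Set.indicator_of_mem hx, Set.indicator_of_mem hx, ← Real.rpow_mul (norm_nonneg _),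
        hpq.sub_one_mul_conj]
    · simp [hx, Real.zero_rpow hpq.symm.ne_zero]
  have key := h g hgm hgr
  rw [hleft, hright, ← ofReal_norm, Complex.norm_real, Real.norm_of_nonneg hJ0] at key
  rw [huS.eLpNorm_eq_integral_rpow_norm (ENNReal.ofReal_pos.2 hp0).ne' (by simp),
    ENNReal.toReal_ofReal hp0.le, ← hJ]
  rcases hJ0.eq_or_lt with h0 | h0
  · rw [← h0, Real.zero_rpow (inv_ne_zero hp0.ne')]; simp
  · have hsplit : J = J ^ p⁻¹ * J ^ q⁻¹ := by
      rw [← Real.rpow_add h0, hpq.inv_add_inv_eq_one, Real.rpow_one]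
    rw [hsplit, ENNReal.ofReal_mul (by positivity), ← hsplit] at key
    exact (ENNReal.mul_le_mul_iff_left (by positivity) ENNReal.ofReal_ne_top).1 key

theorem eLpNorm_le_of_forall_enorm_integral_mul_le [SigmaFinite μ] {u : α → ℂ} (hu : Measurable u)
    {b : ℝ} (hb : ∀ x, ‖u x‖ ≤ b) {p q : ℝ} (hp : 2 ≤ p) (hpq : p.HolderConjugate q) {K : ℝ≥0∞}
    (h : ∀ g : α → ℂ, Measurable g → (∀ r : ℝ≥0∞, MemLp g r μ) →
      ‖∫ x, u x * g x ∂μ‖ₑ ≤ K * eLpNorm g (ENNReal.ofReal q) μ) :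
    eLpNorm u (ENNReal.ofReal p) μ ≤ K := by
  have hp0 : 0 < p := by linarith
  have hS : ∀ n, eLpNorm u (ENNReal.ofReal p) (μ.restrict (spanningSets μ n)) ≤ K := fun n =>
    eLpNorm_restrict_le_of_forall_enorm_integral_mul_le hu hb hp hpq h
      (measurableSet_spanningSets μ n) (measure_spanningSets_lt_top μ n).ne
  have hp' : ENNReal.ofReal p ≠ 0 := (ENNReal.ofReal_pos.2 hp0).ne'
  simp only [eLpNorm_eq_lintegral_rpow_enorm_toReal hp' ENNReal.ofReal_ne_top,
    ENNReal.toReal_ofReal hp0.le, one_div, ENNReal.rpow_inv_le_iff hp0] at hS ⊢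
  rw [← setLIntegral_univ, ← iUnion_spanningSets μ,
    setLIntegral_iUnion_of_directed _ (monotone_spanningSets μ).directed_le]
  exact iSup_le hS

end Duality

section HalfWave

open Filter Topology

theorem dampedSymbol_mul_rpow (t ε δ θ : ℝ) {r : ℝ} (hr : 0 ≤ r) :
    dampedSymbol t ε δ θ r * (r ^ (2 * θ) : ℝ) = Complex.exp (2 * Real.pi * Complex.I * (t * r : ℝ)) *
      (Real.exp (-(ε * r)) * (1 - Real.exp (-(δ * r))) ^ 3 : ℝ) := by
  rcases hr.eq_or_lt with rfl | h0
  · rw [dampedSymbol_zero]; simp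
  · have h1 : (r : ℂ) ^ (-(2 * θ) : ℂ) * (r ^ (2 * θ) : ℝ) = 1 := by
      rw [Complex.ofReal_cpow hr, ← Complex.cpow_add _ _ (by exact_mod_cast h0.ne')]
      push_cast
      rw [neg_add_cancel, Complex.cpow_zero]
    rw [dampedSymbol, mul_right_comm, h1, one_mul]

theorem tendsto_integral_dampedSymbol_mul (t θ : ℝ) {P : EuclideanSpace ℝ (Fin 3) → ℂ}
    (hP : Integrable P) :
    Tendsto (fun n : ℕ => ∫ ξ : EuclideanSpace ℝ (Fin 3),
      dampedSymbol t (1 / ((n : ℝ) + 1)) ((n : ℝ) + 1) θ ‖ξ‖ * ((‖ξ‖ ^ (2 * θ) : ℝ) * P ξ)) atTop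
      (𝓝 (∫ ξ, Complex.exp (2 * Real.pi * Complex.I * (t * ‖ξ‖ : ℝ)) * P ξ)) := by
  simp only [← mul_assoc (dampedSymbol _ _ _ _ _), dampedSymbol_mul_rpow _ _ _ _ (norm_nonneg _)]
  have hE : ∀ r : ℝ, ‖Complex.exp (2 * Real.pi * Complex.I * (t * r : ℝ))‖ = 1 := fun r => by
    rw [Complex.norm_exp]; simp
  refine tendsto_integral_of_dominated_convergence (fun ξ => ‖P ξ‖) (fun n => ?_) hP.norm
    (fun n => Eventually.of_forall fun ξ => ?_) ?_
  · exact AEStronglyMeasurable.mul (by fun_prop) hP.1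
  · rw [norm_mul, norm_mul, hE, one_mul]
    refine mul_le_of_le_one_left (norm_nonneg _) ?_
    obtain ⟨h0, h1, -⟩ := one_sub_exp_neg_mem_Icc
      (x := ((n : ℝ) + 1) * ‖ξ‖) (by positivity)
    rw [Complex.norm_real, Real.norm_of_nonneg (by positivity)]
    refine mul_le_one₀ (Real.exp_le_one_iff.2 ?_) (by positivity) (pow_le_one₀ h0 h1)
    rw [neg_nonpos]; positivity
  · have hne : ∀ᵐ ξ : EuclideanSpace ℝ (Fin 3), ξ ≠ 0 := by simp [ae_iff, measure_singleton]
    filter_upwards [hne] with ξ hξ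
    refine Tendsto.mul_const _ ?_
    have hr : 0 < ‖ξ‖ := norm_pos_iff.2 hξ
    have h1 : Tendsto (fun n : ℕ => Real.exp (-(1 / ((n : ℝ) + 1) * ‖ξ‖))) atTop (𝓝 1) := by
      have := (tendsto_one_div_add_atTop_nhds_zero_nat (𝕜 := ℝ)).mul_const ‖ξ‖
      simpa [Function.comp_def] using (Real.continuous_exp.tendsto _).comp this.neg
    have h2 : Tendsto (fun n : ℕ => Real.exp (-(((n : ℝ) + 1) * ‖ξ‖))) atTop (𝓝 0) := by
      refine Real.tendsto_exp_neg_atTop_nhds_zero.comp (Tendsto.atTop_mul_const hr ?_)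
      exact tendsto_atTop_add_const_right _ _ tendsto_natCast_atTop_atTop
    have h3 := h1.mul ((h2.const_sub 1).pow 3)
    simpa using ((Complex.continuous_ofReal.tendsto _).comp h3).const_mul
      (Complex.exp (2 * Real.pi * Complex.I * (t * ‖ξ‖ : ℝ)))

theorem SchwartzMap.integrable_and_memLp_two_norm_rpow_mul
    (F : SchwartzMap (EuclideanSpace ℝ (Fin 3)) ℂ) {s : ℝ} (hs0 : 0 ≤ s) (hs2 : s ≤ 2) :
    Integrable (fun ξ => (‖ξ‖ ^ s : ℝ) * F ξ) ∧ MemLp (fun ξ => (‖ξ‖ ^ s : ℝ) * F ξ) 2 := by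
  have hm : AEStronglyMeasurable (fun ξ => (‖ξ‖ ^ s : ℝ) * F ξ) :=
    AEStronglyMeasurable.mul (Complex.measurable_ofReal.comp
      (measurable_norm.pow_const s)).aestronglyMeasurable F.continuous.aestronglyMeasurable
  have hb : ∀ ξ, ‖(‖ξ‖ ^ s : ℝ) * F ξ‖ ≤ ‖ξ‖ ^ 0 * ‖F ξ‖ + ‖ξ‖ ^ 2 * ‖F ξ‖ := by
    intro ξ
    rw [norm_mul, Complex.norm_real, Real.norm_of_nonneg (by positivity), ← add_mul]
    gcongr
    rw [pow_zero, ← Real.rpow_two]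
    rcases le_total ‖ξ‖ 1 with h | h
    · exact (Real.rpow_le_one (norm_nonneg _) h hs0).trans (by linarith [Real.rpow_nonneg (norm_nonneg ξ) 2])
    · exact (Real.rpow_le_rpow_of_exponent_le h hs2).trans (by linarith)
  have hi : Integrable (fun ξ => (‖ξ‖ ^ s : ℝ) * F ξ) :=
    ((F.integrable_pow_mul volume 0).add (F.integrable_pow_mul volume 2)).mono' hm
      (Eventually.of_forall hb)
  refine ⟨hi, ?_⟩
  obtain ⟨C0, hC0⟩ := F.decay 0 0
  obtain ⟨C2, hC2⟩ := F.decay 2 0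
  simp only [norm_iteratedFDeriv_zero] at hC0 hC2
  have hbdd : ∀ ξ, ‖‖(‖ξ‖ ^ s : ℝ) * F ξ‖‖ ≤ C0 + C2 := fun ξ => by
    rw [norm_norm]
    exact (hb ξ).trans (add_le_add (hC0.2 ξ) (hC2.2 ξ))
  rw [memLp_two_iff_integrable_sq_norm hm]
  simp only [sq]
  exact hi.norm.bdd_mul hm.norm (Eventually.of_forall hbdd)

theorem halfWave_eq_fourierInv (t : ℝ) (f : EuclideanSpace ℝ (Fin 3) → ℂ) :
    halfWave t f =
      𝓕⁻ fun ξ => Complex.exp (2 * Real.pi * Complex.I * (t * ‖ξ‖ : ℝ)) * 𝓕 f ξ := by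
  ext x
  simp only [halfWave, Real.fourierInv_eq', smul_eq_mul, ← mul_assoc, ← Complex.exp_add]
  congr 1; ext ξ
  rw [real_inner_comm]
  congr 2
  push_cast; ring

theorem lambdaPow_eq_smul_fourierInv (s : ℝ) (f : EuclideanSpace ℝ (Fin 3) → ℂ) :
    lambdaPow s f = (2 * Real.pi) ^ s • 𝓕⁻ fun ξ => (‖ξ‖ ^ s : ℝ) * 𝓕 f ξ := by
  ext x
  simp only [lambdaPow, Pi.smul_apply, Real.fourierInv_eq', smul_eq_mul]
  rw [← integral_smul]
  congr 1; ext ξ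
  rw [real_inner_comm, Real.mul_rpow (by positivity) (norm_nonneg _), Complex.real_smul]
  push_cast
  ring_nf

theorem integrable_exp_mul_fourier (t : ℝ) (f : SchwartzMap (EuclideanSpace ℝ (Fin 3)) ℂ) :
    Integrable fun ξ => Complex.exp (2 * Real.pi * Complex.I * (t * ‖ξ‖ : ℝ)) * 𝓕 (⇑f) ξ := by
  rw [← SchwartzMap.fourier_coe]
  refine (𝓕 f).integrable.bdd_mul (c := 1) (by fun_prop) (Eventually.of_forall fun v => ?_)
  rw [Complex.norm_exp]; simp

theorem enorm_integral_halfWave_mul_le {t θ q : ℝ} (ht : 0 < t)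
    (hθ0 : 0 ≤ θ) (hθ1 : θ < 1) (hqθ : q * (1 + θ) / 2 = 1)
    (f : SchwartzMap (EuclideanSpace ℝ (Fin 3)) ℂ)
    (hfq : MemLp (𝓕⁻ fun ξ => (‖ξ‖ ^ (2 * θ) : ℝ) * 𝓕 (⇑f) ξ) (ENNReal.ofReal q))
    {g : EuclideanSpace ℝ (Fin 3) → ℂ} (hg : Measurable g) (hgr : ∀ r : ℝ≥0∞, MemLp g r) :
    ‖∫ x, halfWave t f x * g x‖ₑ ≤
      ENNReal.ofReal (64 * Real.exp 8 / (1 - θ) * t ^ (-θ)) *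
        (eLpNorm (𝓕⁻ fun ξ => (‖ξ‖ ^ (2 * θ) : ℝ) * 𝓕 (⇑f) ξ) (ENNReal.ofReal q) *
          eLpNorm g (ENNReal.ofReal q)) := by
  have g1 : Integrable g := memLp_one_iff_integrable.1 (hgr 1)
  have hF : Integrable (𝓕 (⇑f)) := by
    rw [← SchwartzMap.fourier_coe]; exact (𝓕 f).integrable
  obtain ⟨H1, H2⟩ := (𝓕 f).integrable_and_memLp_two_norm_rpow_mul (s := 2 * θ)
    (by linarith) (by linarith)
  rw [SchwartzMap.fourier_coe] at H1 H2
  have hP : Integrable fun ξ => 𝓕 (⇑f) ξ * 𝓕⁻ g ξ :=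
    hF.mul_bdd (continuous_fourierInv_of_integrable g1).aestronglyMeasurable
      (Eventually.of_forall (norm_fourierInv_le_integral_norm g))
  rw [halfWave_eq_fourierInv, integral_fourierInv_mul_eq_flip (integrable_exp_mul_fourier t f) g1]
  have hlim := tendsto_integral_dampedSymbol_mul t θ hP
  simp only [← mul_assoc] at hlim ⊢
  refine le_of_tendsto' hlim.enorm fun n => ?_
  have := enorm_integral_dampedSymbol_mul_le (ε := 1 / ((n : ℝ) + 1)) (δ := (n : ℝ) + 1) ht
    (by positivity) (by positivity) hθ0 hθ1 hqθ H1 H2 hfq hg g1 (hgr 2) (hgr _)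
  simpa only [← mul_assoc] using this

end HalfWave

/-- The L^{p'} → L^p dispersive estimate for the half-wave propagator:
‖e^{itΛ}f‖_{L^p} ≤ C t^{−(1−2/p)} ‖Λ^{2−4/p}f‖_{L^{p'}}, 2 ≤ p < ∞, 1/p + 1/p' = 1. -/
theorem halfWave_dispersive_Lp (p : ℝ) (hp : 2 ≤ p) :
    ∃ C : ℝ, 0 < C ∧ ∀ (f : SchwartzMap (EuclideanSpace ℝ (Fin 3)) ℂ) (t : ℝ), 0 < t →
      eLpNorm (halfWave t ⇑f) (ENNReal.ofReal p) volume ≤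
        ENNReal.ofReal (C * t ^ (-(1 - 2 / p))) *
          eLpNorm (lambdaPow (2 - 4 / p) ⇑f) (ENNReal.ofReal (p / (p - 1))) volume := by
  have hp0 : 0 < p := by linarith
  obtain ⟨θ, hθ⟩ : ∃ θ, θ = 1 - 2 / p := ⟨_, rfl⟩
  obtain ⟨q, hq⟩ : ∃ q, q = p / (p - 1) := ⟨_, rfl⟩
  have hs : 2 - 4 / p = 2 * θ := by rw [hθ]; ring
  have hpq : p.HolderConjugate q := by
    rw [hq]; exact Real.HolderConjugate.conjExponent (by linarith)
  have hθ0 : 0 ≤ θ := by rw [hθ, sub_nonneg, div_le_one hp0]; exact hp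
  have hθ1 : θ < 1 := by rw [hθ]; linarith [div_pos two_pos hp0]
  have hqθ : q * (1 + θ) / 2 = 1 := by
    have : p - 1 ≠ 0 := by linarith
    rw [hq, hθ]; field_simp; ring
  rw [← hθ, ← hq, hs]
  have hθ' : 0 < 1 - θ := by linarith
  have h2π : 0 < (2 * Real.pi) ^ (2 * θ) := by positivity
  refine ⟨64 * Real.exp 8 / (1 - θ) / (2 * Real.pi) ^ (2 * θ), by positivity, fun f t ht => ?_⟩
  rw [lambdaPow_eq_smul_fourierInv, eLpNorm_const_smul, ← ofReal_norm,
    Real.norm_of_nonneg h2π.le, ← mul_assoc, ← ENNReal.ofReal_mul (by positivity)]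
  have hC : 64 * Real.exp 8 / (1 - θ) / (2 * Real.pi) ^ (2 * θ) * t ^ (-θ) *
      (2 * Real.pi) ^ (2 * θ) = 64 * Real.exp 8 / (1 - θ) * t ^ (-θ) := by
    field_simp
  rw [hC]
  set h := 𝓕⁻ fun ξ : EuclideanSpace ℝ (Fin 3) => (‖ξ‖ ^ (2 * θ) : ℝ) * 𝓕 (⇑f) ξ with hh
  rcases eq_or_ne (eLpNorm h (ENNReal.ofReal q) volume) ∞ with htop | htop
  · rw [htop, ENNReal.mul_top (ENNReal.ofReal_pos.2 (by positivity)).ne']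
    exact le_top
  have hcont : Continuous h := by
    obtain ⟨H1, -⟩ := (𝓕 f).integrable_and_memLp_two_norm_rpow_mul (s := 2 * θ)
      (by linarith) (by linarith)
    rw [SchwartzMap.fourier_coe] at H1
    exact continuous_fourierInv_of_integrable H1
  have hE := integrable_exp_mul_fourier t f
  have hu : Measurable (halfWave t f) := by
    rw [halfWave_eq_fourierInv]
    exact (continuous_fourierInv_of_integrable hE).measurable
  refine eLpNorm_le_of_forall_enorm_integral_mul_le hu
    (b := ∫ ξ, ‖Complex.exp (2 * Real.pi * Complex.I * (t * ‖ξ‖ : ℝ)) * 𝓕 (⇑f) ξ‖) (fun x => ?_)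
    hp hpq fun g hg hgr => ?_
  · rw [halfWave_eq_fourierInv]
    exact norm_fourierInv_le_integral_norm _ x
  · rw [mul_assoc]
    exact enorm_integral_halfWave_mul_le ht hθ0 hθ1 hqθ f
      ⟨hcont.aestronglyMeasurable, htop.lt_top⟩ hg hgr
end

section
/- There exists a constant C > 0 (one may take C = 4√π) such that for every measurable function g : ℝ³ → ℂ, ‖g‖_{L¹(ℝ³)} ≤ C · ‖ |x| g ‖_{L²(ℝ³)}^{1/2} · ‖ |x|² g ‖_{L²(ℝ³)}^{1/2}, where |x| denotes multiplication by the function x ↦ ‖x‖ (the right-hand side being interpreted as +∞ if either factor is infinite). -/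
open MeasureTheory
open scoped ENNReal

/-- The radial weight `(|x|² + |x|⁴)⁻¹` is integrable on ℝ³. -/
theorem integrable_inv_norm_sq_add_norm_pow_four :
    Integrable (fun x : EuclideanSpace ℝ (Fin 3) => (‖x‖ ^ 2 + ‖x‖ ^ 4)⁻¹) := by
  rw [integrable_fun_norm_addHaar (volume : Measure (EuclideanSpace ℝ (Fin 3)))
    (f := fun r : ℝ => (r ^ 2 + r ^ 4)⁻¹)]
  refine (integrable_inv_one_add_sq.integrableOn).congr_fun (fun r hr => ?_) measurableSet_Ioi
  have hr0 : r ≠ 0 := (Set.mem_Ioi.1 hr).ne'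
  simp only [finrank_euclideanSpace, Fintype.card_fin, smul_eq_mul]
  field_simp

/-- The integral of `(R|x|² + R⁻¹|x|⁴)⁻¹` over ℝ³ does not depend on `R > 0`. -/
theorem lintegral_inv_scaled_weight {R : ℝ} (hR : 0 < R) :
    ∫⁻ x : EuclideanSpace ℝ (Fin 3), ENNReal.ofReal (R * ‖x‖ ^ 2 + R⁻¹ * ‖x‖ ^ 4)⁻¹ =
      ENNReal.ofReal (∫ x : EuclideanSpace ℝ (Fin 3), (‖x‖ ^ 2 + ‖x‖ ^ 4)⁻¹) := by
  have hscale (x : EuclideanSpace ℝ (Fin 3)) :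
      (R * ‖x‖ ^ 2 + R⁻¹ * ‖x‖ ^ 4)⁻¹ =
        (R ^ 3)⁻¹ * (‖R⁻¹ • x‖ ^ 2 + ‖R⁻¹ • x‖ ^ 4)⁻¹ := by
    rw [← mul_inv, norm_smul, Real.norm_of_nonneg (inv_nonneg.2 hR.le)]
    congr 1
    field_simp
  have hint : Integrable fun x : EuclideanSpace ℝ (Fin 3) =>
      (R ^ 3)⁻¹ * (‖R⁻¹ • x‖ ^ 2 + ‖R⁻¹ • x‖ ^ 4)⁻¹ :=
    (integrable_inv_norm_sq_add_norm_pow_four.comp_smul (inv_ne_zero hR.ne')).const_mul _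
  simp_rw [hscale]
  rw [← ofReal_integral_eq_lintegral_ofReal hint (ae_of_all _ fun x => by positivity),
    integral_const_mul, Measure.integral_comp_inv_smul volume
      (fun x : EuclideanSpace ℝ (Fin 3) => (‖x‖ ^ 2 + ‖x‖ ^ 4)⁻¹) R]
  congr 1
  simp only [finrank_euclideanSpace, Fintype.card_fin, smul_eq_mul]
  rw [abs_of_pos (by positivity), inv_mul_cancel_left₀ (by positivity)]

theorem sq_eLpNorm_two {α E : Type*} [MeasurableSpace α] [NormedAddCommGroup E] {μ : Measure α}
    (f : α → E) : eLpNorm f 2 μ ^ 2 = ∫⁻ x, ‖f x‖ₑ ^ 2 ∂μ := by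
  simpa using eLpNorm_nnreal_pow_eq_lintegral (f := f) (μ := μ) (p := 2) two_ne_zero

/-- A function on ℝ³ that vanishes almost everywhere after multiplication by `|x|ⁿ` vanishes
almost everywhere. -/
theorem eLpNorm_one_eq_zero_of_norm_pow_smul {g : EuclideanSpace ℝ (Fin 3) → ℂ}
    (hg : Measurable g) (n : ℕ)
    (h : eLpNorm (fun x => (‖x‖ ^ n : ℝ) • g x) 2 volume = 0) : eLpNorm g 1 volume = 0 := by
  rw [eLpNorm_eq_zero_iff (by fun_prop) two_ne_zero] at h
  rw [eLpNorm_eq_zero_iff (by fun_prop) one_ne_zero]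
  filter_upwards [h, Measure.ae_ne volume (0 : EuclideanSpace ℝ (Fin 3))] with x hx hx0
  simpa [hx0] using hx

/-- Young's inequality with the weight `R|x|² + R⁻¹|x|⁴`. -/
theorem eLpNorm_one_le_weighted_sq {g : EuclideanSpace ℝ (Fin 3) → ℂ} (hg : Measurable g)
    {R l : ℝ} (hR : 0 < R) (hl : 0 < l) :
    eLpNorm g 1 volume ≤
      ENNReal.ofReal l *
          ENNReal.ofReal (∫ x : EuclideanSpace ℝ (Fin 3), (‖x‖ ^ 2 + ‖x‖ ^ 4)⁻¹) +
        (ENNReal.ofReal (R / l) * eLpNorm (fun x => ‖x‖ • g x) 2 volume ^ 2 +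
          ENNReal.ofReal (R⁻¹ / l) * eLpNorm (fun x => (‖x‖ ^ 2 : ℝ) • g x) 2 volume ^ 2) := by
  rw [sq_eLpNorm_two, sq_eLpNorm_two, eLpNorm_one_eq_lintegral_enorm,
    ← lintegral_inv_scaled_weight hR, ← lintegral_const_mul _ (by fun_prop),
    ← lintegral_const_mul _ (by fun_prop), ← lintegral_const_mul _ (by fun_prop),
    ← lintegral_add_left (by fun_prop), ← lintegral_add_left (by fun_prop)]
  refine lintegral_mono_ae ?_
  filter_upwards [Measure.ae_ne volume (0 : EuclideanSpace ℝ (Fin 3))] with x hx0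
  have hx : 0 < ‖x‖ := norm_pos_iff.2 hx0
  simp only [← ofReal_norm, norm_smul, norm_pow, norm_norm]
  rw [← ENNReal.ofReal_pow (by positivity), ← ENNReal.ofReal_pow (by positivity),
    ← ENNReal.ofReal_mul (by positivity), ← ENNReal.ofReal_mul (by positivity),
    ← ENNReal.ofReal_mul (by positivity), ← ENNReal.ofReal_add (by positivity) (by positivity),
    ← ENNReal.ofReal_add (by positivity) (by positivity)]
  refine ENNReal.ofReal_le_ofReal ?_
  set w := R * ‖x‖ ^ 2 + R⁻¹ * ‖x‖ ^ 4 with hw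
  have hwpos : 0 < w := by positivity
  have hsum : R / l * (‖x‖ * ‖g x‖) ^ 2 + R⁻¹ / l * (‖x‖ ^ 2 * ‖g x‖) ^ 2 =
      w / l * ‖g x‖ ^ 2 := by
    rw [hw]; ring
  rw [hsum]
  have hle : 2 * ‖g x‖ ≤ l * w⁻¹ + w / l * ‖g x‖ ^ 2 := by
    have hsq : l * w⁻¹ + w / l * ‖g x‖ ^ 2 - 2 * ‖g x‖ = w / l * (‖g x‖ - l / w) ^ 2 := by
      field_simp
      ring
    have : 0 ≤ w / l * (‖g x‖ - l / w) ^ 2 := by positivity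
    linarith
  linarith [norm_nonneg (g x)]

/-- Weighted interpolation inequality in ℝ³:
‖g‖₁ ≤ C ‖|x|g‖₂^{1/2} ‖|x|²g‖₂^{1/2} (one may take C = 4√π). -/
theorem L1_le_weighted_L2_interpolation :
    ∃ C : ℝ, 0 < C ∧ ∀ g : EuclideanSpace ℝ (Fin 3) → ℂ, Measurable g →
      eLpNorm g 1 volume ≤
        ENNReal.ofReal C *
          (eLpNorm (fun x : EuclideanSpace ℝ (Fin 3) => ‖x‖ • g x) 2 volume) ^ ((1 : ℝ) / 2) *
          (eLpNorm (fun x : EuclideanSpace ℝ (Fin 3) => (‖x‖ ^ 2 : ℝ) • g x) 2 volume)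
            ^ ((1 : ℝ) / 2) := by
  set K : ℝ := ∫ x : EuclideanSpace ℝ (Fin 3), (‖x‖ ^ 2 + ‖x‖ ^ 4)⁻¹ with hK
  have hK0 : 0 ≤ K := integral_nonneg fun x => by positivity
  refine ⟨K + 2, by positivity, fun g hg => ?_⟩
  have hbound := fun {R l : ℝ} => eLpNorm_one_le_weighted_sq hg (R := R) (l := l)
  have hA0 := fun h => eLpNorm_one_eq_zero_of_norm_pow_smul hg 1 (by simpa only [pow_one] using h)
  have hB0 := eLpNorm_one_eq_zero_of_norm_pow_smul hg 2
  rw [← hK] at hbound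
  generalize eLpNorm (fun x : EuclideanSpace ℝ (Fin 3) => ‖x‖ • g x) 2 volume = A at *
  generalize eLpNorm (fun x : EuclideanSpace ℝ (Fin 3) => (‖x‖ ^ 2 : ℝ) • g x) 2 volume = B at *
  rcases eq_or_ne A 0 with hA | hA
  · simp [hA0 hA]
  rcases eq_or_ne B 0 with hB | hB
  · simp [hB0 hB]
  have hC : ENNReal.ofReal (K + 2) ≠ 0 := by
    rw [ENNReal.ofReal_ne_zero_iff]; positivity
  rcases eq_or_ne A ⊤ with hA' | hA'
  · simp [hA', hB, hC, ENNReal.mul_top, ENNReal.top_mul]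
  rcases eq_or_ne B ⊤ with hB' | hB'
  · simp [hB', hA, hC, ENNReal.mul_top]
  have ha : 0 < A.toReal := ENNReal.toReal_pos hA hA'
  have hb : 0 < B.toReal := ENNReal.toReal_pos hB hB'
  rw [← ENNReal.ofReal_toReal hA', ← ENNReal.ofReal_toReal hB'] at hbound ⊢
  generalize A.toReal = a at *
  generalize B.toReal = b at *
  refine (hbound (div_pos hb ha) (mul_pos (Real.sqrt_pos.2 ha) (Real.sqrt_pos.2 hb))).trans ?_
  rw [ENNReal.ofReal_rpow_of_pos ha, ENNReal.ofReal_rpow_of_pos hb, ← Real.sqrt_eq_rpow,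
    ← Real.sqrt_eq_rpow]
  obtain ⟨s, hs, rfl⟩ : ∃ s : ℝ, 0 < s ∧ s ^ 2 = a := ⟨√a, Real.sqrt_pos.2 ha, Real.sq_sqrt ha.le⟩
  obtain ⟨t, ht, rfl⟩ : ∃ t : ℝ, 0 < t ∧ t ^ 2 = b := ⟨√b, Real.sqrt_pos.2 hb, Real.sq_sqrt hb.le⟩
  rw [Real.sqrt_sq hs.le, Real.sqrt_sq ht.le,
    ← ENNReal.ofReal_pow (by positivity), ← ENNReal.ofReal_pow (by positivity),
    ← ENNReal.ofReal_mul (by positivity), ← ENNReal.ofReal_mul (by positivity),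
    ← ENNReal.ofReal_mul (by positivity), ← ENNReal.ofReal_mul (by positivity),
    ← ENNReal.ofReal_mul (by positivity), ← ENNReal.ofReal_add (by positivity) (by positivity),
    ← ENNReal.ofReal_add (by positivity) (by positivity)]
  refine ENNReal.ofReal_le_ofReal (le_of_eq ?_)
  field_simp
  ring
end
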